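/- arXiv:1702.02648 — 3 statements merged into one kernel-verified Lean document; each statement's English description precedes it below -/
import Mathlib

section
/- Let H be a strictly 1-balanced graph with at least 2 vertices and at least one edge, and let COV_H be the event that every vertex of G(n,p) is contained in a copy of H. Then (log n)^{1/e(H)}/n^{1/m_1(H)} is a threshold for COV_H: if p·n^{1/m_1(H)}/(log n)^{1/e(H)} → 0 then a.a.s. some vertex of G(n,p) lies in no copy of H, while if p·n^{1/m_1(H)}/(log n)^{1/e(H)} → ∞ then a.a.s. every vertex of G(n,p) lies in a copy of H. -/
open MeasureTheory Filter Topology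

/-- Bernoulli measure on `Bool` with success probability `p` (clamped to `[0,1]`). -/
noncomputable def bernoulliMeasure (p : ℝ) : Measure Bool :=
  (min (ENNReal.ofReal p) 1) • Measure.dirac true +
    (1 - min (ENNReal.ofReal p) 1) • Measure.dirac false

/-- The distribution of the binomial random graph `G(n,p)`, as a product of independent
Bernoulli measures, one for each potential edge. -/
noncomputable def gnp (n : ℕ) (p : ℝ) : Measure (Sym2 (Fin n) → Bool) :=
  Measure.pi fun _ => bernoulliMeasure p

/-- The simple graph on `[n]` determined by an outcome of the edge indicators. -/
def graphOf {n : ℕ} (ω : Sym2 (Fin n) → Bool) : SimpleGraph (Fin n) :=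
  SimpleGraph.fromRel fun u v => ω s(u, v) = true

/-- `G` contains a (not necessarily induced) copy of `H`. -/
def ContainsCopy {α β : Type*} (H : SimpleGraph α) (G : SimpleGraph β) : Prop :=
  ∃ f : α → β, Function.Injective f ∧ ∀ ⦃u v⦄, H.Adj u v → G.Adj (f u) (f v)

/-- The maximum degree of a graph on a finite vertex type. -/
noncomputable def maxDeg {V : Type*} [Fintype V] (G : SimpleGraph V) : ℕ :=
  Finset.univ.sup fun v => (G.neighborSet v).ncard

/-- The maximum 0-density `m₀(H)`. -/
noncomputable def m0 {V : Type*} [Fintype V] (H : SimpleGraph V) : ℝ :=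
  sSup {x : ℝ | ∃ H' : H.Subgraph, H'.verts.Nonempty ∧
    x = (H'.edgeSet.ncard : ℝ) / (H'.verts.ncard : ℝ)}

/-- The maximum 1-density `m₁(H)`. -/
noncomputable def m1 {V : Type*} [Fintype V] (H : SimpleGraph V) : ℝ :=
  sSup {x : ℝ | ∃ H' : H.Subgraph, 1 < H'.verts.ncard ∧
    x = (H'.edgeSet.ncard : ℝ) / ((H'.verts.ncard : ℝ) - 1)}

/-- The maximum 2-density `m₂(H)`. -/
noncomputable def m2 {V : Type*} [Fintype V] (H : SimpleGraph V) : ℝ :=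
  sSup {x : ℝ | ∃ H' : H.Subgraph, 0 < H'.edgeSet.ncard ∧
    x = if 2 < H'.verts.ncard
      then ((H'.edgeSet.ncard : ℝ) - 1) / ((H'.verts.ncard : ℝ) - 2)
      else 1 / 2}

/-- The maximum Riordan-density `m_R(H)`. -/
noncomputable def mR {V : Type*} [Fintype V] (H : SimpleGraph V) : ℝ :=
  sSup {x : ℝ | ∃ H' : H.Subgraph, 2 < H'.verts.ncard ∧
    x = (H'.edgeSet.ncard : ℝ) / ((H'.verts.ncard : ℝ) - 2)}

/-- The local 1-density `m₁(x,H)` of `H` at the vertex `x`. -/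
noncomputable def m1At {V : Type*} [Fintype V] (H : SimpleGraph V) (x : V) : ℝ :=
  sSup {r : ℝ | ∃ H' : H.Subgraph, x ∈ H'.verts ∧ 1 < H'.verts.ncard ∧
    r = (H'.edgeSet.ncard : ℝ) / ((H'.verts.ncard : ℝ) - 1)}

/-- `H` is strictly 1-balanced: `H` itself is the unique maximiser of the 1-density. -/
def StrictlyOneBalanced {V : Type*} [Fintype V] (H : SimpleGraph V) : Prop :=
  ∀ H' : H.Subgraph, 1 < H'.verts.ncard → H' ≠ ⊤ →
    (H'.edgeSet.ncard : ℝ) / ((H'.verts.ncard : ℝ) - 1) <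
      (H.edgeSet.ncard : ℝ) / ((Fintype.card V : ℝ) - 1)

/-- `H` is vertex-1-balanced: the local 1-density at every vertex equals `m₁(H)`. -/
def VertexOneBalanced {V : Type*} [Fintype V] (H : SimpleGraph V) : Prop :=
  ∀ x : V, m1At H x = m1 H

/-- `G` (an `n`-vertex graph) contains an `H`-factor: `⌊n / v(H)⌋` pairwise vertex-disjoint
copies of `H`. -/
def HasFactor {V : Type*} [Fintype V] (H : SimpleGraph V) {n : ℕ}
    (G : SimpleGraph (Fin n)) : Prop :=
  ∃ f : Fin (n / Fintype.card V) × V → Fin n, Function.Injective f ∧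
    ∀ (i : Fin (n / Fintype.card V)) ⦃u v : V⦄, H.Adj u v → G.Adj (f (i, u)) (f (i, v))



set_option linter.unusedSectionVars false

section Generic
variable {E : Type*} [Fintype E] [DecidableEq E]

/-- product weight -/
noncomputable def wt (p : ℝ) (ω : E → Bool) : ℝ := ∏ e, if ω e then p else 1 - p

/-- expectation -/
noncomputable def ex (p : ℝ) (g : (E → Bool) → ℝ) : ℝ := ∑ ω, wt p ω * g ω

/-- indicator that all of `F` is present -/
noncomputable def ind (F : Finset E) (ω : E → Bool) : ℝ := if ∀ e ∈ F, ω e = true then 1 else 0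

/-- `g` does not depend on coordinates in `F` -/
def NoDep (F : Finset E) (g : (E → Bool) → ℝ) : Prop :=
  ∀ ω ω' : E → Bool, (∀ e, e ∉ F → ω e = ω' e) → g ω = g ω'

/-- average over the coordinates in `F` -/
noncomputable def av (p : ℝ) (F : Finset E) (g : (E → Bool) → ℝ) (ω : E → Bool) : ℝ :=
  ex p fun η => g (F.piecewise η ω)

lemma wt_nonneg {p : ℝ} (h0 : 0 ≤ p) (h1 : p ≤ 1) (ω : E → Bool) : 0 ≤ wt p ω := by
  unfold wt
  refine Finset.prod_nonneg fun e _ => ?_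
  split_ifs <;> linarith

lemma ex_mono {p : ℝ} (h0 : 0 ≤ p) (h1 : p ≤ 1) {f g : (E → Bool) → ℝ} (h : ∀ ω, f ω ≤ g ω) :
    ex p f ≤ ex p g :=
  Finset.sum_le_sum fun ω _ => mul_le_mul_of_nonneg_left (h ω) (wt_nonneg h0 h1 ω)

lemma ex_prod (p : ℝ) (c : E → Bool → ℝ) :
    ex p (fun ω => ∏ e, c e (ω e)) = ∏ e, (p * c e true + (1 - p) * c e false) := by
  have : ∀ e, (p * c e true + (1 - p) * c e false)
      = ∑ b : Bool, (if b then p else 1 - p) * c e b := by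
    intro e; simp
  simp_rw [this]
  rw [Finset.prod_univ_sum]
  unfold ex wt
  rw [Fintype.piFinset_univ]
  exact Finset.sum_congr rfl fun ω _ => (Finset.prod_mul_distrib).symm

lemma ex_one (p : ℝ) : ex p (fun _ : E → Bool => 1) = 1 := by
  have := ex_prod (E := E) p (fun _ _ => 1)
  simpa using this

lemma sum_wt (p : ℝ) : ∑ ω : E → Bool, wt p ω = 1 := by
  have := ex_one (E := E) p
  simpa [ex] using this

lemma ex_const (p c : ℝ) : ex p (fun _ : E → Bool => c) = c := by
  unfold ex
  rw [← Finset.sum_mul, sum_wt, one_mul]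

lemma ex_add (p : ℝ) (f g : (E → Bool) → ℝ) : ex p (fun ω => f ω + g ω) = ex p f + ex p g := by
  simp [ex, mul_add, Finset.sum_add_distrib]

lemma ex_sub (p : ℝ) (f g : (E → Bool) → ℝ) : ex p (fun ω => f ω - g ω) = ex p f - ex p g := by
  simp [ex, mul_sub, Finset.sum_sub_distrib]

lemma ex_mul_left (p c : ℝ) (f : (E → Bool) → ℝ) : ex p (fun ω => c * f ω) = c * ex p f := by
  simp only [ex, Finset.mul_sum]
  refine Finset.sum_congr rfl fun _ _ => by ring

lemma ex_sum {ι : Type*} (s : Finset ι) (p : ℝ) (f : ι → (E → Bool) → ℝ) :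
    ex p (fun ω => ∑ i ∈ s, f i ω) = ∑ i ∈ s, ex p (f i) := by
  simp only [ex, Finset.mul_sum]
  rw [Finset.sum_comm]

lemma ind_eq_prod (F : Finset E) (ω : E → Bool) :
    ind F ω = ∏ e, if e ∈ F then (if ω e then 1 else 0 : ℝ) else 1 := by
  unfold ind
  rw [Finset.prod_ite_mem, Finset.univ_inter, Finset.prod_ite_zero]
  simp

lemma ex_ind (p : ℝ) (F : Finset E) : ex p (ind F) = p ^ F.card := by
  have := ex_prod (E := E) p (fun e b => if e ∈ F then (if b then 1 else 0 : ℝ) else 1)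
  have h2 : (ind F) = fun ω => ∏ e, if e ∈ F then (if ω e then 1 else 0 : ℝ) else 1 := by
    funext ω; exact ind_eq_prod F ω
  rw [h2, this]
  rw [← Finset.prod_const, ← Finset.univ_inter F, ← Finset.prod_ite_mem, Finset.univ_inter]
  refine Finset.prod_congr rfl fun e _ => ?_
  by_cases he : e ∈ F <;> simp [he]

lemma ind_mul (F G : Finset E) (ω : E → Bool) : ind F ω * ind G ω = ind (F ∪ G) ω := by
  unfold ind
  by_cases h1 : ∀ e ∈ F, ω e = true
  · by_cases h2 : ∀ e ∈ G, ω e = true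
    · rw [if_pos h1, if_pos h2, if_pos]
      · simp
      · intro e he
        rcases Finset.mem_union.1 he with h | h
        exacts [h1 e h, h2 e h]
    · rw [if_neg h2, mul_zero, if_neg]
      exact fun h => h2 fun e he => h e (Finset.mem_union_right _ he)
  · rw [if_neg h1, zero_mul, if_neg]
    exact fun h => h1 fun e he => h e (Finset.mem_union_left _ he)

lemma ind_nonneg (F : Finset E) (ω : E → Bool) : 0 ≤ ind F ω := by
  unfold ind; split_ifs <;> norm_num

lemma ind_le_one (F : Finset E) (ω : E → Bool) : ind F ω ≤ 1 := by
  unfold ind; split_ifs <;> norm_num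

lemma ind_mono (F : Finset E) : Monotone (ind F) := by
  intro a b hab
  unfold ind
  split_ifs with h1 h2
  · exact le_rfl
  · exact absurd (fun e he => by have := hab e; rw [h1 e he] at this; exact top_le_iff.1 this) h2
  · norm_num
  · exact le_rfl

/-- swap coordinates in F between two configurations -/
lemma ex_av (p : ℝ) (F : Finset E) (g : (E → Bool) → ℝ) : ex p (av p F g) = ex p g := by
  have h1 : ex p (av p F g) = ∑ z : (E → Bool) × (E → Bool),
      wt p z.1 * wt p z.2 * g (F.piecewise z.2 z.1) := by
    rw [Fintype.sum_prod_type]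
    simp only [ex, av, Finset.mul_sum, mul_assoc]
  have h2 : ex p g = ∑ z : (E → Bool) × (E → Bool), wt p z.1 * wt p z.2 * g z.1 := by
    rw [Fintype.sum_prod_type]
    unfold ex
    refine Finset.sum_congr rfl fun ω _ => ?_
    have : ∀ η : E → Bool, wt p ω * wt p η * g ω = wt p η * (wt p ω * g ω) := by intro η; ring
    simp_rw [this]
    rw [← Finset.sum_mul, sum_wt, one_mul]
  rw [h1, h2]
  have inv : Function.Involutive (fun z : (E → Bool) × (E → Bool) =>
      (F.piecewise z.2 z.1, F.piecewise z.1 z.2)) := by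
    rintro ⟨a, b⟩
    ext e <;> by_cases he : e ∈ F <;> simp [he]
  refine Fintype.sum_equiv inv.toPerm _ _ ?_
  rintro ⟨a, b⟩
  simp only [Function.Involutive.coe_toPerm]
  congr 1
  unfold wt
  rw [← Finset.prod_mul_distrib, ← Finset.prod_mul_distrib]
  refine Finset.prod_congr rfl fun e _ => ?_
  by_cases he : e ∈ F <;> simp [he, mul_comm]

lemma noDep_piecewise {F : Finset E} {g : (E → Bool) → ℝ} (h : NoDep F g) (η ω : E → Bool) :
    g (F.piecewise η ω) = g ω :=
  h _ _ fun e he => by simp [he]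

lemma av_mul {p : ℝ} {F : Finset E} {h g : (E → Bool) → ℝ} (hh : NoDep F h) (ω : E → Bool) :
    av p F (fun ω => h ω * g ω) ω = h ω * av p F g ω := by
  unfold av
  simp_rw [noDep_piecewise hh]
  rw [ex_mul_left]

lemma noDep_av_self (p : ℝ) (F : Finset E) (g : (E → Bool) → ℝ) : NoDep F (av p F g) := by
  intro ω ω' h
  unfold av
  congr 1
  funext η
  congr 1
  ext e
  by_cases he : e ∈ F <;> simp [he, h]

lemma noDep_av {p : ℝ} {F G : Finset E} {g : (E → Bool) → ℝ} (hg : NoDep G g) :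
    NoDep G (av p F g) := by
  intro ω ω' h
  unfold av
  congr 1
  funext η
  apply hg
  intro e he
  by_cases he' : e ∈ F <;> simp [he', h e he]

lemma NoDep.mul {F : Finset E} {f g : (E → Bool) → ℝ} (hf : NoDep F f) (hg : NoDep F g) :
    NoDep F (fun ω => f ω * g ω) := fun ω ω' h => by
  simp only [hf ω ω' h, hg ω ω' h]

lemma NoDep.prod {ι : Type*} {F : Finset E} {s : Finset ι} {f : ι → (E → Bool) → ℝ}
    (hf : ∀ i ∈ s, NoDep F (f i)) : NoDep F (fun ω => ∏ i ∈ s, f i ω) := fun ω ω' h =>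
  Finset.prod_congr rfl fun i hi => hf i hi ω ω' h

lemma NoDep.sum {ι : Type*} {F : Finset E} {s : Finset ι} {f : ι → (E → Bool) → ℝ}
    (hf : ∀ i ∈ s, NoDep F (f i)) : NoDep F (fun ω => ∑ i ∈ s, f i ω) := fun ω ω' h =>
  Finset.sum_congr rfl fun i hi => hf i hi ω ω' h

lemma noDep_ind {F G : Finset E} (h : Disjoint F G) : NoDep F (ind G) := by
  intro ω ω' hω
  unfold ind
  have : ∀ e ∈ G, ω e = ω' e := fun e he => hω e fun h' => (Finset.disjoint_left.1 h) h' he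
  have : (∀ e ∈ G, ω e = true) ↔ (∀ e ∈ G, ω' e = true) := by
    constructor
    · intro h e he; rw [← this e he]; exact h e he
    · intro h e he; rw [this e he]; exact h e he
  simp only [this]

lemma ex_ind_mul {p : ℝ} {F : Finset E} {g : (E → Bool) → ℝ} (hg : NoDep F g) :
    ex p (fun ω => ind F ω * g ω) = p ^ F.card * ex p g := by
  rw [← ex_av p F]
  have : av p F (fun ω => ind F ω * g ω) = fun ω => p ^ F.card * g ω := by
    funext ω
    have h1 : (fun ω => ind F ω * g ω) = fun ω => g ω * ind F ω := by funext ω; ring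
    rw [h1, av_mul hg, mul_comm]
    congr 1
    unfold av
    rw [← ex_ind p F]
    congr 1
    funext η
    unfold ind
    congr 1
    simp +contextual
  rw [this, ex_mul_left]

/-- conditional independence -/
lemma ex_prod_av {p : ℝ} {ι : Type*} [DecidableEq ι] (Ev : ι → Finset E)
    (g : ι → (E → Bool) → ℝ) (T : Finset ι) (S : Finset ι) (hTS : T ⊆ S)
    (hind : ∀ v ∈ S, ∀ w ∈ S, v ≠ w → NoDep (Ev w) (g v)) (h : (E → Bool) → ℝ)
    (hh : ∀ v ∈ S, NoDep (Ev v) h) :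
    ex p (fun ω => h ω * ∏ v ∈ T, g v ω) = ex p (fun ω => h ω * ∏ v ∈ T, av p (Ev v) (g v) ω) := by
  induction T using Finset.induction_on generalizing h with
  | empty => simp
  | insert a T ha ih =>
    have haS : a ∈ S := hTS (Finset.mem_insert_self _ _)
    have hT : T ⊆ S := fun x hx => hTS (Finset.mem_insert_of_mem hx)
    simp_rw [Finset.prod_insert ha]
    have h1 : ex p (fun ω => h ω * (g a ω * ∏ v ∈ T, g v ω))
        = ex p (fun ω => (h ω * av p (Ev a) (g a) ω) * ∏ v ∈ T, g v ω) := by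
      rw [← ex_av p (Ev a)]
      congr 1
      funext ω
      have hnd : NoDep (Ev a) (fun ω => h ω * ∏ v ∈ T, g v ω) :=
        (hh a haS).mul (NoDep.prod fun v hv => hind v (hT hv) a haS
          (fun hva => ha (hva ▸ hv)))
      have h2 : (fun ω => h ω * (g a ω * ∏ v ∈ T, g v ω))
          = fun ω => (h ω * ∏ v ∈ T, g v ω) * g a ω := by funext ω; ring
      rw [h2, av_mul hnd]
      ring
    rw [h1, ih hT (fun ω => h ω * av p (Ev a) (g a) ω)]
    · simp only [mul_assoc]
    · intro v hv
      by_cases hva : v = a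
      · subst hva
        exact (hh v hv).mul (noDep_av_self _ _ _)
      · exact (hh v hv).mul (noDep_av (hind a haS v hv (Ne.symm hva)))

lemma wt_inf_sup (p : ℝ) (a b : E → Bool) : wt p a * wt p b = wt p (a ⊓ b) * wt p (a ⊔ b) := by
  unfold wt
  rw [← Finset.prod_mul_distrib, ← Finset.prod_mul_distrib]
  refine Finset.prod_congr rfl fun e _ => ?_
  simp only [Pi.inf_apply, Pi.sup_apply]
  by_cases ha : a e = true <;> by_cases hb : b e = true <;> simp [ha, hb, mul_comm]

/-- Harris/FKG for decreasing functions bounded by one, under conditioning on `ind F`. -/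
lemma harris {p : ℝ} (h0 : 0 ≤ p) (h1 : p ≤ 1) (F : Finset E) {f g : (E → Bool) → ℝ}
    (hf : Antitone f) (hg : Antitone g) (hf1 : ∀ ω, f ω ≤ 1) (hg1 : ∀ ω, g ω ≤ 1) :
    ex p (fun ω => ind F ω * f ω) * ex p (fun ω => ind F ω * g ω)
      ≤ p ^ F.card * ex p (fun ω => ind F ω * (f ω * g ω)) := by
  have key := fkg (α := E → Bool) (μ := fun ω => wt p ω * ind F ω) (f := fun ω => 1 - f ω)
    (g := fun ω => 1 - g ω)
    (fun ω => mul_nonneg (wt_nonneg h0 h1 ω) (ind_nonneg F ω))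
    (fun ω => sub_nonneg.2 (hf1 ω)) (fun ω => sub_nonneg.2 (hg1 ω))
    (fun a b hab => sub_le_sub_left (hf hab) 1) (fun a b hab => sub_le_sub_left (hg hab) 1)
    (by
      intro a b
      have e1 : wt p a * ind F a * (wt p b * ind F b)
        = (wt p a * wt p b) * (ind F a * ind F b) := by ring
      have e2 : wt p (a ⊓ b) * ind F (a ⊓ b) * (wt p (a ⊔ b) * ind F (a ⊔ b))
        = (wt p (a ⊓ b) * wt p (a ⊔ b)) * (ind F (a ⊓ b) * ind F (a ⊔ b)) := by ring
      rw [e1, e2, ← wt_inf_sup]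
      refine mul_le_mul_of_nonneg_left ?_ (mul_nonneg (wt_nonneg h0 h1 a) (wt_nonneg h0 h1 b))
      unfold ind
      by_cases ha : ∀ e ∈ F, a e = true
      · by_cases hb : ∀ e ∈ F, b e = true
        · rw [if_pos ha, if_pos hb, if_pos, if_pos]
          · intro e he; simp [ha e he]
          · intro e he; simp [ha e he, hb e he]
        · rw [if_neg hb, mul_zero]; positivity
      · rw [if_neg ha, zero_mul]; positivity)
  have c0 : ∑ ω : E → Bool, wt p ω * ind F ω = p ^ F.card := ex_ind p F
  have cf : ∑ ω : E → Bool, wt p ω * ind F ω * (1 - f ω)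
      = p ^ F.card - ex p (fun ω => ind F ω * f ω) := by
    rw [← ex_ind, ← ex_sub]; exact Finset.sum_congr rfl fun _ _ => by ring
  have cg : ∑ ω : E → Bool, wt p ω * ind F ω * (1 - g ω)
      = p ^ F.card - ex p (fun ω => ind F ω * g ω) := by
    rw [← ex_ind, ← ex_sub]; exact Finset.sum_congr rfl fun _ _ => by ring
  have cfg : ∑ ω : E → Bool, wt p ω * ind F ω * ((1 - f ω) * (1 - g ω))
      = p ^ F.card - ex p (fun ω => ind F ω * f ω) - ex p (fun ω => ind F ω * g ω)
        + ex p (fun ω => ind F ω * (f ω * g ω)) := by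
    rw [← ex_ind, ← ex_sub, ← ex_sub, ← ex_add]; exact Finset.sum_congr rfl fun _ _ => by ring
  rw [c0, cf, cg, cfg] at key
  nlinarith [key]

lemma harris' {p : ℝ} (h0 : 0 ≤ p) (h1 : p ≤ 1) {f g : (E → Bool) → ℝ}
    (hf : Antitone f) (hg : Antitone g) (hf1 : ∀ ω, f ω ≤ 1) (hg1 : ∀ ω, g ω ≤ 1) :
    ex p f * ex p g ≤ ex p (fun ω => f ω * g ω) := by
  have := harris h0 h1 ∅ hf hg hf1 hg1
  simpa [ind] using this

lemma harris_prod {p : ℝ} (h0 : 0 ≤ p) (h1 : p ≤ 1) {ι : Type*} (s : Finset ι)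
    (f : ι → (E → Bool) → ℝ) (hf : ∀ i ∈ s, Antitone (f i)) (hf0 : ∀ i ∈ s, ∀ ω, 0 ≤ f i ω)
    (hf1 : ∀ i ∈ s, ∀ ω, f i ω ≤ 1) :
    ∏ i ∈ s, ex p (f i) ≤ ex p (fun ω => ∏ i ∈ s, f i ω) := by
  classical
  induction s using Finset.induction_on with
  | empty => simp [ex_one]
  | insert a s ha ih =>
    simp_rw [Finset.prod_insert ha]
    have m : ∀ i ∈ s, i ∈ insert a s := fun i hi => Finset.mem_insert_of_mem hi
    have ma := Finset.mem_insert_self a s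
    have e0 : 0 ≤ ex p (f a) :=
      Finset.sum_nonneg fun ω _ => mul_nonneg (wt_nonneg h0 h1 ω) (hf0 a ma ω)
    refine (mul_le_mul_of_nonneg_left (ih (fun i hi => hf i (m i hi))
      (fun i hi => hf0 i (m i hi)) (fun i hi => hf1 i (m i hi))) e0).trans ?_
    refine harris' h0 h1 (hf a ma) ?_ (hf1 a ma) ?_
    · intro x y hxy
      exact Finset.prod_le_prod (fun i hi => hf0 i (m i hi) y) (fun i hi => hf i (m i hi) hxy)
    · intro ω
      exact Finset.prod_le_one (fun i hi => hf0 i (m i hi) ω) (fun i hi => hf1 i (m i hi) ω)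

end Generic

section Generic2
variable {E : Type*} [Fintype E] [DecidableEq E]

lemma ex_nonneg {p : ℝ} (h0 : 0 ≤ p) (h1 : p ≤ 1) {f : (E → Bool) → ℝ} (h : ∀ ω, 0 ≤ f ω) :
    0 ≤ ex p f :=
  Finset.sum_nonneg fun ω _ => mul_nonneg (wt_nonneg h0 h1 ω) (h ω)

lemma antitone_exp_ind {ι : Type*} (s : Finset ι) (S : ι → Finset E) {t : ℝ} (ht : 0 ≤ t) :
    Antitone (fun ω : E → Bool => Real.exp (-(t * ∑ i ∈ s, ind (S i) ω))) := by
  intro a b hab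
  apply Real.exp_le_exp.2
  apply neg_le_neg
  exact mul_le_mul_of_nonneg_left (Finset.sum_le_sum fun i _ => ind_mono (S i) hab) ht

lemma sum_ind_nonneg {ι : Type*} (s : Finset ι) (S : ι → Finset E) (ω : E → Bool) :
    0 ≤ ∑ i ∈ s, ind (S i) ω := Finset.sum_nonneg fun _ _ => ind_nonneg _ _

lemma exp_ind_le_one {ι : Type*} (s : Finset ι) (S : ι → Finset E) {t : ℝ} (ht : 0 ≤ t)
    (ω : E → Bool) : Real.exp (-(t * ∑ i ∈ s, ind (S i) ω)) ≤ 1 := by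
  rw [Real.exp_le_one_iff]
  have := mul_nonneg ht (sum_ind_nonneg s S ω)
  linarith

lemma janson_step {p : ℝ} (h0 : 0 ≤ p) (h1 : p ≤ 1) {ι : Type*} [DecidableEq ι]
    (s : Finset ι) (S : ι → Finset E) {t : ℝ} (ht : 0 ≤ t) (i : ι) :
    (p ^ (S i).card - t * ∑ j ∈ s with ¬ Disjoint (S i) (S j), p ^ (S i ∪ S j).card)
        * ex p (fun ω => Real.exp (-(t * ∑ i ∈ s, ind (S i) ω)))
      ≤ ex p (fun ω => ind (S i) ω * Real.exp (-(t * ∑ i ∈ s, ind (S i) ω))) := by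
  set A := s.filter (fun j => ¬ Disjoint (S i) (S j)) with hA
  set B := s.filter (fun j => Disjoint (S i) (S j)) with hB
  set f : (E → Bool) → ℝ := fun ω => Real.exp (-(t * ∑ i ∈ A, ind (S i) ω)) with hf
  set g : (E → Bool) → ℝ := fun ω => Real.exp (-(t * ∑ i ∈ B, ind (S i) ω)) with hg
  have hfg : ∀ ω, Real.exp (-(t * ∑ i ∈ s, ind (S i) ω)) = f ω * g ω := by
    intro ω
    simp only [hf, hg]
    rw [← Real.exp_add]
    congr 1
    rw [← Finset.sum_filter_add_sum_filter_not s (fun j => Disjoint (S i) (S j))]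
    ring
  have hΨ0 : 0 ≤ ex p (fun ω => Real.exp (-(t * ∑ i ∈ s, ind (S i) ω))) :=
    ex_nonneg h0 h1 fun ω => (Real.exp_pos _).le
  have hR0 : 0 ≤ ex p (fun ω => ind (S i) ω * Real.exp (-(t * ∑ i ∈ s, ind (S i) ω))) :=
    ex_nonneg h0 h1 fun ω => mul_nonneg (ind_nonneg _ _) (Real.exp_pos _).le
  have hsum0 : 0 ≤ ∑ j ∈ A, p ^ (S i ∪ S j).card := Finset.sum_nonneg fun j _ => pow_nonneg h0 _
  rcases (pow_nonneg h0 (S i).card).eq_or_lt with hp | hp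
  · rw [← hp]
    refine le_trans ?_ hR0
    have := mul_nonneg (mul_nonneg ht hsum0) hΨ0
    linarith
  · have H := harris h0 h1 (S i) (antitone_exp_ind A S ht) (antitone_exp_ind B S ht)
      (exp_ind_le_one A S ht) (exp_ind_le_one B S ht)
    change ex p (fun ω => ind (S i) ω * f ω) * ex p (fun ω => ind (S i) ω * g ω) ≤
      p ^ (S i).card * ex p (fun ω => ind (S i) ω * (f ω * g ω)) at H
    have hgn : NoDep (S i) g := by
      have : NoDep (S i) (fun ω => ∑ j ∈ B, ind (S j) ω) :=
        NoDep.sum fun j hj => noDep_ind (Finset.mem_filter.1 hj).2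
      intro ω ω' h
      have h2 := this ω ω' h
      simp only [hg]
      simp only at h2
      rw [h2]
    rw [ex_ind_mul hgn] at H
    have H2 : ex p (fun ω => ind (S i) ω * f ω) * ex p g
        ≤ ex p (fun ω => ind (S i) ω * (f ω * g ω)) := by
      refine le_of_mul_le_mul_left ?_ hp
      linarith [H]
    have e1 : ex p (fun ω => ind (S i) ω * Real.exp (-(t * ∑ i ∈ s, ind (S i) ω)))
        = ex p (fun ω => ind (S i) ω * (f ω * g ω)) := by simp_rw [hfg]
    rw [e1]
    refine le_trans ?_ H2
    have e2 : ex p (fun ω => Real.exp (-(t * ∑ i ∈ s, ind (S i) ω))) ≤ ex p g := by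
      refine ex_mono h0 h1 fun ω => ?_
      rw [hfg]
      exact mul_le_of_le_one_left (Real.exp_pos _).le (exp_ind_le_one A S ht ω)
    have e3 : p ^ (S i).card - t * ∑ j ∈ A, p ^ (S i ∪ S j).card
        ≤ ex p (fun ω => ind (S i) ω * f ω) := by
      have : p ^ (S i).card - t * ∑ j ∈ A, p ^ (S i ∪ S j).card
          = ex p (fun ω => ind (S i) ω * (1 - t * ∑ j ∈ A, ind (S j) ω)) := by
        have : (fun ω => ind (S i) ω * (1 - t * ∑ j ∈ A, ind (S j) ω))
            = fun ω => ind (S i) ω - t * ∑ j ∈ A, ind (S i ∪ S j) ω := by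
          funext ω
          simp_rw [← ind_mul]
          rw [← Finset.mul_sum]
          ring
        rw [this, ex_sub, ex_mul_left, ex_sum, ex_ind]
        simp_rw [ex_ind]
      rw [this]
      refine ex_mono h0 h1 fun ω => mul_le_mul_of_nonneg_left ?_ (ind_nonneg _ _)
      have := Real.add_one_le_exp (-(t * ∑ i ∈ A, ind (S i) ω))
      simp only [hf]
      linarith
    have e4 : 0 ≤ ex p (fun ω => ind (S i) ω * f ω) :=
      ex_nonneg h0 h1 fun ω => mul_nonneg (ind_nonneg _ _) (Real.exp_pos _).le
    exact (mul_le_mul_of_nonneg_right e3 hΨ0).trans (mul_le_mul_of_nonneg_left e2 e4)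

/-- Janson's inequality. -/
lemma janson {p : ℝ} (h0 : 0 ≤ p) (h1 : p ≤ 1) {ι : Type*} [DecidableEq ι]
    (s : Finset ι) (S : ι → Finset E) {D : ℝ}
    (hD : ∑ i ∈ s, ∑ j ∈ s with ¬ Disjoint (S i) (S j), p ^ (S i ∪ S j).card ≤ D)
    {t : ℝ} (ht : 0 ≤ t) :
    ex p (fun ω => ∏ i ∈ s, (1 - ind (S i) ω))
      ≤ Real.exp (-(t * ∑ i ∈ s, p ^ (S i).card) + t ^ 2 * D / 2) := by
  set μ := ∑ i ∈ s, p ^ (S i).card with hμ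
  set Ψ : ℝ → ℝ := fun t => ex p (fun ω => Real.exp (-(t * ∑ i ∈ s, ind (S i) ω))) with hΨ
  have hder : ∀ t, HasDerivAt Ψ
      (-∑ i ∈ s, ex p (fun ω => ind (S i) ω * Real.exp (-(t * ∑ i ∈ s, ind (S i) ω)))) t := by
    intro t
    rw [← ex_sum]
    have : -ex p (fun ω => ∑ i ∈ s, ind (S i) ω * Real.exp (-(t * ∑ i ∈ s, ind (S i) ω)))
        = ∑ ω, wt p ω * (Real.exp (-(t * ∑ i ∈ s, ind (S i) ω)) * (-(∑ i ∈ s, ind (S i) ω))) := by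
      unfold ex
      rw [← Finset.sum_neg_distrib]
      refine Finset.sum_congr rfl fun ω _ => ?_
      beta_reduce
      rw [← Finset.sum_mul]
      ring
    rw [this]
    simp only [hΨ, ex]
    refine HasDerivAt.fun_sum fun ω _ => HasDerivAt.const_mul _ (HasDerivAt.exp ?_)
    have := ((hasDerivAt_id' t).mul_const (∑ i ∈ s, ind (S i) ω)).fun_neg
    rw [one_mul] at this
    exact this
  set G : ℝ → ℝ := fun t => Ψ t * Real.exp (t * μ - t ^ 2 * D / 2) with hG
  have hGder : ∀ t, HasDerivAt G
      ((-∑ i ∈ s, ex p (fun ω => ind (S i) ω * Real.exp (-(t * ∑ i ∈ s, ind (S i) ω))))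
        * Real.exp (t * μ - t ^ 2 * D / 2)
        + Ψ t * (Real.exp (t * μ - t ^ 2 * D / 2) * (μ - t * D))) t := by
    intro t
    refine (hder t).mul (HasDerivAt.exp ?_)
    have h3 := ((hasDerivAt_id' t).mul_const μ).fun_sub
      ((((hasDerivAt_id' t).fun_pow 2).mul_const D).div_const 2)
    refine h3.congr_deriv ?_
    push_cast
    ring
  have hanti : AntitoneOn G (Set.Ici 0) := by
    refine antitoneOn_of_deriv_nonpos (convex_Ici 0)
      (fun t _ => (hGder t).continuousAt.continuousWithinAt)
      (fun t _ => (hGder t).differentiableAt.differentiableWithinAt) ?_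
    intro t ht
    rw [interior_Ici] at ht
    have ht' : 0 ≤ t := (Set.mem_Ioi.1 ht).le
    rw [(hGder t).deriv]
    have hΨ0 : 0 ≤ Ψ t := ex_nonneg h0 h1 fun ω => (Real.exp_pos _).le
    have h2 : (μ - t * D) * Ψ t
        ≤ ∑ i ∈ s, ex p (fun ω => ind (S i) ω * Real.exp (-(t * ∑ i ∈ s, ind (S i) ω))) := by
      refine le_trans ?_ (Finset.sum_le_sum fun i _ => janson_step h0 h1 s S ht' i)
      rw [← Finset.sum_mul]
      refine mul_le_mul_of_nonneg_right ?_ hΨ0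
      rw [Finset.sum_sub_distrib, ← Finset.mul_sum]
      have := mul_le_mul_of_nonneg_left hD ht'
      linarith
    have h3 := mul_le_mul_of_nonneg_right h2 (Real.exp_pos (t * μ - t ^ 2 * D / 2)).le
    linarith
  have h4 : G t ≤ G 0 := hanti (Set.mem_Ici.2 le_rfl) (Set.mem_Ici.2 ht) ht
  have h5 : G 0 = 1 := by simp [hG, hΨ, ex_one]
  rw [h5] at h4
  have h6 : Ψ t ≤ Real.exp (-(t * μ) + t ^ 2 * D / 2) := by
    have : Real.exp (-(t * μ) + t ^ 2 * D / 2) = 1 / Real.exp (t * μ - t ^ 2 * D / 2) := by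
      rw [one_div, ← Real.exp_neg]; congr 1; ring
    rw [this, le_div_iff₀ (Real.exp_pos _)]
    exact h4
  refine le_trans (ex_mono h0 h1 fun ω => ?_) h6
  rw [Finset.mul_sum, ← Finset.sum_neg_distrib, Real.exp_sum]
  refine Finset.prod_le_prod (fun i _ => sub_nonneg.2 (ind_le_one _ _)) fun i _ => ?_
  unfold ind
  split_ifs
  · simp [Real.exp_nonneg]
  · simp

lemma exp_neg_two_le {x : ℝ} (h0 : 0 ≤ x) (h1 : x ≤ 1 / 2) : Real.exp (-(2 * x)) ≤ 1 - x := by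
  have h := Real.add_one_le_exp (2 * x)
  rw [Real.exp_neg, inv_le_comm₀ (Real.exp_pos _) (by linarith)]
  refine le_trans ?_ h
  rw [inv_le_iff_one_le_mul₀ (by linarith)]
  nlinarith

lemma av_lower {p : ℝ} (h0 : 0 ≤ p) (h1 : p ≤ 1 / 2) {ι : Type*}
    (F : Finset E) (C : Finset ι) (S : ι → Finset E) (hne : ∀ i ∈ C, (S i ∩ F).Nonempty)
    (ω : E → Bool) :
    Real.exp (-(2 * ∑ i ∈ C, p ^ (S i ∩ F).card * ind (S i \ F) ω))
      ≤ av p F (fun ω => ∏ i ∈ C, (1 - ind (S i) ω)) ω := by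
  have hp1 : p ≤ 1 := by linarith
  have e1 : av p F (fun ω => ∏ i ∈ C, (1 - ind (S i) ω)) ω
      = ex p (fun η => ∏ i ∈ C, (1 - ind (S i \ F) ω * ind (S i ∩ F) η)) := by
    unfold av
    congr 1
    funext η
    refine Finset.prod_congr rfl fun i _ => ?_
    congr 1
    have : S i = (S i \ F) ∪ (S i ∩ F) := by
      rw [Finset.sdiff_union_inter]
    conv_lhs => rw [this]
    rw [← ind_mul]
    congr 1
    · refine noDep_piecewise (noDep_ind ?_) η ω
      exact Finset.disjoint_sdiff
    · unfold ind
      congr 1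
      apply propext
      refine forall₂_congr fun e he => ?_
      rw [Finset.piecewise_eq_of_mem _ _ _ (Finset.mem_inter.1 he).2]
  rw [e1]
  refine le_trans ?_ (harris_prod h0 hp1 C _ ?_ ?_ ?_)
  · rw [Finset.mul_sum, ← Finset.sum_neg_distrib, Real.exp_sum]
    refine Finset.prod_le_prod (fun _ _ => (Real.exp_pos _).le) fun i hi => ?_
    rw [ex_sub, ex_one, ex_mul_left, ex_ind]
    have hq : p ^ (S i ∩ F).card ≤ 1 / 2 := by
      have hc : (S i ∩ F).card ≠ 0 := by
        have := Finset.card_pos.2 (hne i hi); omega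
      exact (pow_le_of_le_one h0 hp1 hc).trans h1
    have hq0 : 0 ≤ p ^ (S i ∩ F).card := pow_nonneg h0 _
    have i0 := ind_nonneg (S i \ F) ω
    have i1 := ind_le_one (S i \ F) ω
    rw [mul_comm (ind _ _)]
    refine exp_neg_two_le (mul_nonneg hq0 i0) ?_
    nlinarith
  · intro i _ a b hab
    exact sub_le_sub_left (mul_le_mul_of_nonneg_left (ind_mono _ hab) (ind_nonneg _ _)) 1
  · intro i _ η
    have := mul_le_one₀ (ind_le_one (S i \ F) ω) (ind_nonneg (S i ∩ F) η) (ind_le_one (S i ∩ F) η)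
    linarith
  · intro i _ η
    have := mul_nonneg (ind_nonneg (S i \ F) ω) (ind_nonneg (S i ∩ F) η)
    linarith

/-- the core of the 0-statement -/
lemma zero_core {p : ℝ} (h0 : 0 ≤ p) (h1 : p ≤ 1 / 2) {ι κ : Type*} [DecidableEq κ]
    (T : Finset κ) (hT : T.Nonempty) (Ev : κ → Finset E)
    (C : κ → Finset ι) (S : ι → Finset E)
    (hne : ∀ v ∈ T, ∀ i ∈ C v, (S i ∩ Ev v).Nonempty)
    (hdis : ∀ v ∈ T, ∀ w ∈ T, v ≠ w → ∀ i ∈ C v, Disjoint (Ev w) (S i))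
    {t : ℝ} (ht : 0 < t) :
    ex p (fun ω => ∏ v ∈ T, (1 - ∏ i ∈ C v, (1 - ind (S i) ω)))
      ≤ (∑ v ∈ T, ∑ i ∈ C v, p ^ (S i).card) / (T.card * t)
        + Real.exp (-(T.card * Real.exp (-(2 * t)))) := by
  have hp1 : p ≤ 1 := by linarith
  have hc : (0 : ℝ) < T.card := by exact_mod_cast Finset.card_pos.2 hT
  have step1 := ex_prod_av (p := p) Ev (fun v ω => 1 - ∏ i ∈ C v, (1 - ind (S i) ω)) T T
    (Finset.Subset.refl _) (by
      intro v hv w hw hvw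
      have : NoDep (Ev w) (fun ω => ∏ i ∈ C v, (1 - ind (S i) ω)) := by
        refine NoDep.prod fun i hi => ?_
        intro ω ω' h
        simp only [noDep_ind (hdis v hv w hw hvw i hi) ω ω' h]
      intro ω ω' h
      have := this ω ω' h
      simp only at this ⊢
      rw [this]) (fun _ => 1) (fun v _ ω ω' _ => rfl)
  simp only [one_mul] at step1
  rw [step1]
  set Y : κ → (E → Bool) → ℝ := fun v ω => ∑ i ∈ C v, p ^ (S i ∩ Ev v).card * ind (S i \ Ev v) ω
    with hY
  have hY0 : ∀ v ω, 0 ≤ Y v ω := fun v ω =>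
    Finset.sum_nonneg fun i _ => mul_nonneg (pow_nonneg h0 _) (ind_nonneg _ _)
  have hav : ∀ v ∈ T, ∀ ω, av p (Ev v) (fun ω => 1 - ∏ i ∈ C v, (1 - ind (S i) ω)) ω
      ≤ 1 - Real.exp (-(2 * Y v ω)) := by
    intro v hv ω
    have := av_lower h0 h1 (Ev v) (C v) S (hne v hv) ω
    have e : av p (Ev v) (fun ω => 1 - ∏ i ∈ C v, (1 - ind (S i) ω)) ω
        = 1 - av p (Ev v) (fun ω => ∏ i ∈ C v, (1 - ind (S i) ω)) ω := by
      unfold av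
      rw [ex_sub, ex_one]
    rw [e]
    simp only [hY]
    linarith
  have hav0 : ∀ v ∈ T, ∀ ω, 0 ≤ av p (Ev v) (fun ω => 1 - ∏ i ∈ C v, (1 - ind (S i) ω)) ω := by
    intro v hv ω
    refine ex_nonneg h0 hp1 fun η => sub_nonneg.2 ?_
    exact Finset.prod_le_one (fun i _ => sub_nonneg.2 (ind_le_one _ _))
      (fun i _ => by linarith [ind_nonneg (S i) ((Ev v).piecewise η ω)])
  have point : ∀ ω, ∏ v ∈ T, av p (Ev v) (fun ω => 1 - ∏ i ∈ C v, (1 - ind (S i) ω)) ω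
      ≤ (1 / (T.card * t)) * (∑ v ∈ T, Y v ω) + Real.exp (-(T.card * Real.exp (-(2 * t)))) := by
    intro ω
    have b1 : ∏ v ∈ T, av p (Ev v) (fun ω => 1 - ∏ i ∈ C v, (1 - ind (S i) ω)) ω
        ≤ Real.exp (-∑ v ∈ T, Real.exp (-(2 * Y v ω))) := by
      rw [← Finset.sum_neg_distrib, Real.exp_sum]
      refine Finset.prod_le_prod (fun v hv => hav0 v hv ω) fun v hv => (hav v hv ω).trans ?_
      have := Real.add_one_le_exp (-Real.exp (-(2 * Y v ω)))
      linarith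
    have jens : Real.exp (-(2 * ((∑ v ∈ T, Y v ω) / T.card))) * T.card
        ≤ ∑ v ∈ T, Real.exp (-(2 * Y v ω)) := by
      have := convexOn_exp.map_sum_le (t := T) (w := fun _ => 1 / (T.card : ℝ))
        (p := fun v => -(2 * Y v ω)) (fun _ _ => by positivity)
        (by rw [Finset.sum_const, nsmul_eq_mul]; field_simp) (fun _ _ => Set.mem_univ _)
      simp only [smul_eq_mul] at this
      rw [← Finset.mul_sum, ← Finset.mul_sum, Finset.sum_neg_distrib, ← Finset.mul_sum] at this
      have e : 1 / (T.card : ℝ) * -(2 * ∑ v ∈ T, Y v ω) = -(2 * ((∑ v ∈ T, Y v ω) / T.card)) := by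
        field_simp
      rw [e] at this
      have h2 := mul_le_mul_of_nonneg_right this hc.le
      refine h2.trans (le_of_eq ?_)
      field_simp
    have s0 : 0 ≤ ∑ v ∈ T, Y v ω := Finset.sum_nonneg fun v _ => hY0 v ω
    by_cases hle : (∑ v ∈ T, Y v ω) / T.card ≤ t
    · refine b1.trans ?_
      have : Real.exp (-∑ v ∈ T, Real.exp (-(2 * Y v ω)))
          ≤ Real.exp (-(T.card * Real.exp (-(2 * t)))) := by
        apply Real.exp_le_exp.2
        apply neg_le_neg
        refine le_trans ?_ jens
        rw [mul_comm]
        refine mul_le_mul_of_nonneg_right (Real.exp_le_exp.2 ?_) hc.le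
        linarith
      have h3 : 0 ≤ (1 / (T.card * t)) * (∑ v ∈ T, Y v ω) := by positivity
      linarith
    · push Not at hle
      have h3 : 1 ≤ (1 / (T.card * t)) * (∑ v ∈ T, Y v ω) := by
        rw [lt_div_iff₀ hc] at hle
        rw [one_div, ← div_eq_inv_mul, le_div_iff₀ (by positivity)]
        linarith
      have h4 : ∏ v ∈ T, av p (Ev v) (fun ω => 1 - ∏ i ∈ C v, (1 - ind (S i) ω)) ω ≤ 1 := by
        refine b1.trans ?_
        rw [Real.exp_le_one_iff]
        have : 0 ≤ ∑ v ∈ T, Real.exp (-(2 * Y v ω)) := Finset.sum_nonneg fun _ _ => (Real.exp_pos _).le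
        linarith
      have := Real.exp_pos (-(T.card * Real.exp (-(2 * t))))
      linarith
  refine (ex_mono h0 hp1 point).trans ?_
  rw [ex_add, ex_const, ex_mul_left, ex_sum]
  apply le_of_eq
  congr 1
  rw [one_div, ← div_eq_inv_mul]
  congr 1
  refine Finset.sum_congr rfl fun v _ => ?_
  simp only [hY]
  rw [ex_sum]
  refine Finset.sum_congr rfl fun i _ => ?_
  rw [ex_mul_left, ex_ind, ← pow_add]
  congr 1
  exact Finset.card_inter_add_card_sdiff _ _

end Generic2

section GraphPart

instance bernoulli_finite (p : ℝ) : IsFiniteMeasure (bernoulliMeasure p) := by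
  constructor
  simp only [bernoulliMeasure, Measure.coe_add, Measure.coe_smul, Pi.add_apply, Pi.smul_apply,
    measure_univ, smul_eq_mul, mul_one]
  refine ENNReal.add_lt_top.2 ⟨?_, ?_⟩
  · exact (min_le_right _ _).trans_lt ENNReal.one_lt_top
  · exact tsub_le_self.trans_lt ENNReal.one_lt_top

lemma bernoulli_singleton {p : ℝ} (h0 : 0 ≤ p) (h1 : p ≤ 1) (b : Bool) :
    bernoulliMeasure p {b} = ENNReal.ofReal (if b then p else 1 - p) := by
  have hm : min (ENNReal.ofReal p) 1 = ENNReal.ofReal p := min_eq_left (by simpa using h1)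
  unfold bernoulliMeasure
  rw [hm]
  cases b
  · simp [ENNReal.ofReal_sub _ h0]
  · simp

lemma gnp_apply (n : ℕ) {p : ℝ} (h0 : 0 ≤ p) (h1 : p ≤ 1) (A : Set (Sym2 (Fin n) → Bool)) :
    gnp n p A = ENNReal.ofReal (ex p (A.indicator fun _ => 1)) := by
  classical
  have hs : ∀ ω, gnp n p {ω} = ENNReal.ofReal (wt p ω) := by
    intro ω
    unfold gnp wt
    rw [Measure.pi_singleton, ENNReal.ofReal_prod_of_nonneg]
    · exact Finset.prod_congr rfl fun e _ => bernoulli_singleton h0 h1 _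
    · intro e _
      split_ifs <;> linarith
  have hA : A = ↑(A.toFinite.toFinset) := by simp
  conv_lhs => rw [hA]
  rw [← sum_measure_singleton]
  simp_rw [hs]
  rw [← ENNReal.ofReal_sum_of_nonneg fun ω _ => wt_nonneg h0 h1 ω]
  congr 1
  unfold ex
  simp only [Set.indicator_apply, mul_ite, mul_one, mul_zero]
  rw [← Finset.sum_filter]
  refine Finset.sum_congr ?_ fun _ _ => rfl
  ext ω
  simp

variable {V : Type} [Fintype V] (H : SimpleGraph V)

open Classical in
/-- edges of the image of `H` under `f` -/
noncomputable def eS {n : ℕ} (f : V → Fin n) : Finset (Sym2 (Fin n)) :=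
  (H.edgeSet.toFinite.toFinset).image (Sym2.map f)

lemma mem_eS {n : ℕ} (f : V → Fin n) (e : Sym2 (Fin n)) :
    e ∈ eS H f ↔ ∃ a b, H.Adj a b ∧ s(f a, f b) = e := by
  unfold eS
  rw [Finset.mem_image]
  constructor
  · rintro ⟨x, hx, rfl⟩
    induction x with
    | h a b => exact ⟨a, b, by simpa using hx, by simp⟩
  · rintro ⟨a, b, hab, rfl⟩
    exact ⟨s(a, b), by simpa using hab, by simp⟩

lemma card_eS {n : ℕ} (f : V → Fin n) (hf : Function.Injective f) :
    (eS H f).card = H.edgeSet.ncard := by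
  unfold eS
  rw [Finset.card_image_of_injective _ (Sym2.map.injective hf), Set.ncard_eq_toFinset_card]

lemma copy_iff {n : ℕ} (f : V → Fin n) (hf : Function.Injective f) (ω : Sym2 (Fin n) → Bool) :
    (∀ ⦃a b⦄, H.Adj a b → (graphOf ω).Adj (f a) (f b)) ↔ ∀ e ∈ eS H f, ω e = true := by
  constructor
  · intro h e he
    obtain ⟨a, b, hab, rfl⟩ := (mem_eS H f e).1 he
    have := h hab
    simp only [graphOf, SimpleGraph.fromRel_adj] at this
    rcases this.2 with h | h
    · exact h
    · rwa [Sym2.eq_swap]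
  · intro h a b hab
    simp only [graphOf, SimpleGraph.fromRel_adj]
    exact ⟨fun h' => hab.ne (hf h'), Or.inl (h _ ((mem_eS H f _).2 ⟨a, b, hab, rfl⟩))⟩

/-- the covering event -/
def covSet (n : ℕ) : Set (Sym2 (Fin n) → Bool) :=
  {ω | ∀ v : Fin n, ∃ f : V → Fin n, Function.Injective f ∧
          (∀ ⦃a b⦄, H.Adj a b → (graphOf ω).Adj (f a) (f b)) ∧ ∃ x, f x = v}

lemma mem_covSet {n : ℕ} (ω : Sym2 (Fin n) → Bool) : ω ∈ covSet H n ↔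
    ∀ v : Fin n, ∃ f : V → Fin n, Function.Injective f ∧ ind (eS H f) ω = 1 ∧ ∃ x, f x = v := by
  unfold covSet
  simp only [Set.mem_ofPred_eq]
  refine forall_congr' fun v => exists_congr fun f => and_congr_right fun hf => ?_
  rw [copy_iff H f hf]
  refine and_congr_left fun _ => ?_
  unfold ind
  split_ifs with h
  · simpa using h
  · simpa using h

lemma card_root [DecidableEq V] {n : ℕ} (x : V) (v : Fin n) :
    (Finset.univ.filter fun f : V → Fin n => f x = v).card = n ^ (Fintype.card V - 1) := by
  have : (Finset.univ.filter fun f : V → Fin n => f x = v)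
      = Fintype.piFinset (fun y => if y = x then {v} else Finset.univ) := by
    ext f
    simp only [Finset.mem_filter, Finset.mem_univ, true_and, Fintype.mem_piFinset]
    constructor
    · intro h y
      by_cases hy : y = x
      · subst hy; simp [h]
      · simp [hy]
    · intro h
      simpa using h x
  rw [this, Fintype.card_piFinset, ← Finset.mul_prod_erase _ _ (Finset.mem_univ x)]
  rw [Finset.prod_congr rfl (g := fun _ => n)]
  · simp [Finset.card_erase_of_mem]
  · intro y hy
    simp [(Finset.mem_erase.1 hy).1]

lemma card_two [DecidableEq V] {n : ℕ} {y z : V} (hyz : y ≠ z) (T : Finset (Fin n)) :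
    (Finset.univ.filter fun f : V → Fin n => f y ∈ T ∧ f z ∈ T).card
      = T.card ^ 2 * n ^ (Fintype.card V - 2) := by
  have : (Finset.univ.filter fun f : V → Fin n => f y ∈ T ∧ f z ∈ T)
      = Fintype.piFinset (fun x => if x = y ∨ x = z then T else Finset.univ) := by
    ext f
    simp only [Finset.mem_filter, Finset.mem_univ, true_and, Fintype.mem_piFinset]
    constructor
    · rintro ⟨h1, h2⟩ x
      by_cases hx : x = y ∨ x = z
      · rw [if_pos hx]
        rcases hx with rfl | rfl <;> assumption
      · simp [hx]
    · intro h
      exact ⟨by simpa using h y, by simpa using h z⟩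
  rw [this, Fintype.card_piFinset, ← Finset.mul_prod_erase _ _ (Finset.mem_univ y),
    ← Finset.mul_prod_erase _ _ (Finset.mem_erase.2 ⟨hyz.symm, Finset.mem_univ z⟩)]
  rw [Finset.prod_congr rfl (g := fun _ => n)]
  · simp only [true_or, or_true, if_true, Finset.prod_const]
    rw [Finset.card_erase_of_mem (Finset.mem_erase.2 ⟨hyz.symm, Finset.mem_univ z⟩),
      Finset.card_erase_of_mem (Finset.mem_univ y), Finset.card_univ, Nat.sub_sub]
    ring
  · intro x hx
    have h1 := (Finset.mem_erase.1 hx).1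
    have h2 := (Finset.mem_erase.1 (Finset.mem_erase.1 hx).2).1
    simp [h1, h2]

lemma zero_bound (hiso : ∀ x, ∃ y, H.Adj x y) {n : ℕ} {p : ℝ} (h0 : 0 ≤ p) (h1 : p ≤ 1 / 2)
    (T : Finset (Fin n)) (hT : T.Nonempty) {t : ℝ} (ht : 0 < t) :
    ex p ((covSet H n).indicator fun _ => 1)
      ≤ (Fintype.card V) ^ 2 * (T.card ^ 2 * n ^ (Fintype.card V - 2)) * p ^ H.edgeSet.ncard
        + (Fintype.card V * n ^ (Fintype.card V - 1) * p ^ H.edgeSet.ncard) / t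
        + Real.exp (-(T.card * Real.exp (-(2 * t)))) := by
  classical
  have hp1 : p ≤ 1 := by linarith
  set D : Finset (V → Fin n) := Finset.univ.filter fun f => Function.Injective f ∧
    ∃ y z, y ≠ z ∧ f y ∈ T ∧ f z ∈ T with hD
  set C : Fin n → Finset (V → Fin n) := fun v => Finset.univ.filter fun f =>
    Function.Injective f ∧ (∃ x, f x = v) ∧ ∀ y, f y ∈ T → f y = v with hC
  have hpe : 0 ≤ p ^ H.edgeSet.ncard := pow_nonneg h0 _
  have point : ∀ ω, (covSet H n).indicator (fun _ => (1 : ℝ)) ω ≤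
      (∑ f ∈ D, ind (eS H f) ω) + ∏ v ∈ T, (1 - ∏ f ∈ C v, (1 - ind (eS H f) ω)) := by
    intro ω
    have n1 : 0 ≤ ∑ f ∈ D, ind (eS H f) ω := sum_ind_nonneg _ _ _
    have n2 : 0 ≤ ∏ v ∈ T, (1 - ∏ f ∈ C v, (1 - ind (eS H f) ω)) := by
      refine Finset.prod_nonneg fun v _ => sub_nonneg.2 ?_
      exact Finset.prod_le_one (fun f _ => sub_nonneg.2 (ind_le_one _ _))
        (fun f _ => by linarith [ind_nonneg (eS H f) ω])
    by_cases hω : ω ∈ covSet H n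
    · rw [Set.indicator_of_mem hω]
      by_cases hex : ∃ f ∈ D, ind (eS H f) ω = 1
      · obtain ⟨f, hf, hf1⟩ := hex
        have := Finset.single_le_sum (f := fun f => ind (eS H f) ω)
          (fun f _ => ind_nonneg _ _) hf
        simp only [hf1] at this
        linarith
      · have : ∏ v ∈ T, (1 - ∏ f ∈ C v, (1 - ind (eS H f) ω)) = 1 := by
          refine Finset.prod_eq_one fun v hv => ?_
          obtain ⟨f, hf, hf1, x, hx⟩ := (mem_covSet H ω).1 hω v
          have hfC : f ∈ C v := by
            simp only [hC, Finset.mem_filter, Finset.mem_univ, true_and]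
            refine ⟨hf, ⟨x, hx⟩, fun y hy => ?_⟩
            by_contra hne
            refine hex ⟨f, ?_, hf1⟩
            simp only [hD, Finset.mem_filter, Finset.mem_univ, true_and]
            refine ⟨hf, y, x, ?_, hy, hx ▸ hv⟩
            rintro rfl
            exact hne hx
          rw [Finset.prod_eq_zero hfC (by rw [hf1, sub_self]), sub_zero]
        rw [this]
        linarith
    · rw [Set.indicator_of_notMem hω]
      linarith
  refine (ex_mono h0 hp1 point).trans ?_
  rw [ex_add, ex_sum]
  have core := zero_core h0 h1 T hT (fun v => Finset.univ.filter fun e : Sym2 (Fin n) => v ∈ e) C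
    (eS H) (by
      intro v _ f hf
      simp only [hC, Finset.mem_filter, Finset.mem_univ, true_and] at hf
      obtain ⟨_, ⟨x, rfl⟩, _⟩ := hf
      obtain ⟨y, hy⟩ := hiso x
      refine ⟨s(f x, f y), Finset.mem_inter.2 ⟨(mem_eS H f _).2 ⟨x, y, hy, rfl⟩, ?_⟩⟩
      simp) (by
      intro v hv w hw hvw f hf
      simp only [hC, Finset.mem_filter, Finset.mem_univ, true_and] at hf
      rw [Finset.disjoint_left]
      intro e he he'
      obtain ⟨a, b, _, rfl⟩ := (mem_eS H f _).1 he'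
      simp only [Finset.mem_filter, Finset.mem_univ, true_and, Sym2.mem_iff] at he
      rcases he with rfl | rfl
      · exact hvw (hf.2.2 a hw).symm
      · exact hvw (hf.2.2 b hw).symm) ht
  have b1 : ∑ f ∈ D, ex p (ind (eS H f)) ≤
      (Fintype.card V) ^ 2 * (T.card ^ 2 * n ^ (Fintype.card V - 2)) * p ^ H.edgeSet.ncard := by
    have : ∀ f ∈ D, ex p (ind (eS H f)) = p ^ H.edgeSet.ncard := by
      intro f hf
      rw [ex_ind, card_eS H f (Finset.mem_filter.1 hf).2.1]
    rw [Finset.sum_congr rfl this, Finset.sum_const, nsmul_eq_mul]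
    refine mul_le_mul_of_nonneg_right ?_ hpe
    have hsub : D ⊆ (Finset.univ.filter fun q : V × V => q.1 ≠ q.2).biUnion fun q =>
        Finset.univ.filter fun f : V → Fin n => f q.1 ∈ T ∧ f q.2 ∈ T := by
      intro f hf
      obtain ⟨_, y, z, hyz, hy, hz⟩ := (Finset.mem_filter.1 hf).2
      rw [Finset.mem_biUnion]
      exact ⟨(y, z), by simpa using hyz, by simpa using ⟨hy, hz⟩⟩
    have hcard : D.card ≤ (Fintype.card V) ^ 2 * (T.card ^ 2 * n ^ (Fintype.card V - 2)) := by
      refine (Finset.card_le_card hsub).trans ?_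
      refine (Finset.card_biUnion_le_card_mul _ _ (T.card ^ 2 * n ^ (Fintype.card V - 2)) ?_).trans ?_
      · intro q hq
        exact (card_two (Finset.mem_filter.1 hq).2 T).le
      · refine Nat.mul_le_mul_right _ ((Finset.card_filter_le _ _).trans ?_)
        rw [Finset.card_univ, Fintype.card_prod, sq]
    exact_mod_cast hcard
  have b2 : (∑ v ∈ T, ∑ f ∈ C v, p ^ (eS H f).card) / (T.card * t)
      ≤ (Fintype.card V * n ^ (Fintype.card V - 1) * p ^ H.edgeSet.ncard) / t := by
    have hc : (0 : ℝ) < T.card := by exact_mod_cast Finset.card_pos.2 hT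
    have hv : ∀ v ∈ T, ∑ f ∈ C v, p ^ (eS H f).card
        ≤ Fintype.card V * n ^ (Fintype.card V - 1) * p ^ H.edgeSet.ncard := by
      intro v _
      have : ∀ f ∈ C v, p ^ (eS H f).card = p ^ H.edgeSet.ncard := by
        intro f hf
        rw [card_eS H f (Finset.mem_filter.1 hf).2.1]
      rw [Finset.sum_congr rfl this, Finset.sum_const, nsmul_eq_mul]
      refine mul_le_mul_of_nonneg_right ?_ hpe
      have hsub : C v ⊆ (Finset.univ : Finset V).biUnion fun x =>
          Finset.univ.filter fun f : V → Fin n => f x = v := by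
        intro f hf
        obtain ⟨_, ⟨x, hx⟩, _⟩ := (Finset.mem_filter.1 hf).2
        rw [Finset.mem_biUnion]
        exact ⟨x, Finset.mem_univ _, by simpa using hx⟩
      have hcard : (C v).card ≤ Fintype.card V * n ^ (Fintype.card V - 1) := by
        refine (Finset.card_le_card hsub).trans ?_
        exact Finset.card_biUnion_le_card_mul _ _ _ fun x _ => (card_root x v).le
      exact_mod_cast hcard
    have hs := Finset.sum_le_sum hv
    rw [Finset.sum_const, nsmul_eq_mul] at hs
    rw [div_le_div_iff₀ (by positivity) ht]
    nlinarith
  linarith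

end GraphPart

section OnePart

variable {V : Type} [Fintype V] (H : SimpleGraph V)

lemma rooted_lower [DecidableEq V] {n : ℕ} (x : V) (v : Fin n) :
    (n - (Fintype.card V - 1)) ^ (Fintype.card V - 1) ≤
    (Finset.univ.filter fun f : V → Fin n => Function.Injective f ∧ f x = v).card := by
  have hc1 : Fintype.card {y : V // y ≠ x} = Fintype.card V - 1 := by
    simp [Fintype.card_subtype_compl]
  have hc2 : Fintype.card {z : Fin n // z ≠ v} = n - 1 := by
    simp [Fintype.card_subtype_compl]
  have h1 : (n - (Fintype.card V - 1)) ^ (Fintype.card V - 1)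
      ≤ Fintype.card ({y : V // y ≠ x} ↪ {z : Fin n // z ≠ v}) := by
    rw [Fintype.card_embedding_eq, hc1, hc2]
    refine le_trans ?_ (Nat.pow_sub_le_descFactorial _ _)
    refine Nat.pow_le_pow_left ?_ _
    have := v.pos
    omega
  refine h1.trans ?_
  rw [← Finset.card_univ]
  refine Finset.card_le_card_of_injOn
    (fun φ y => if h : y = x then v else (φ ⟨y, h⟩ : Fin n)) ?_ ?_
  · intro φ _
    simp only [Finset.coe_filter, Finset.mem_univ, true_and, Set.mem_ofPred_eq]
    refine ⟨?_, by simp⟩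
    intro a b hab
    by_cases ha : a = x
    · by_cases hb : b = x
      · rw [ha, hb]
      · simp only [ha, hb, dite_true, dite_false] at hab
        exact absurd hab.symm (φ ⟨b, hb⟩).2
    · by_cases hb : b = x
      · simp only [ha, hb, dite_true, dite_false] at hab
        exact absurd hab (φ ⟨a, ha⟩).2
      · simp only [ha, hb, dite_false] at hab
        have := φ.injective (Subtype.ext hab)
        simpa using this
  · intro φ _ ψ _ h
    ext ⟨y, hy⟩
    have := congrFun h y
    simp only [hy, dite_false] at this
    rw [this]

/-- overlap subgraph -/
def overlap {n : ℕ} (f g : V → Fin n) (hf : Function.Injective f) : H.Subgraph where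
  verts := {y | g y ∈ Set.range f}
  Adj a b := H.Adj a b ∧ s(g a, g b) ∈ eS H f
  adj_sub h := h.1
  edge_vert := by
    rintro a b ⟨_, h⟩
    obtain ⟨c, d, _, h⟩ := (mem_eS H f _).1 h
    rcases Sym2.eq_iff.1 h with ⟨h1, h2⟩ | ⟨h1, h2⟩
    · exact ⟨c, h1⟩
    · exact ⟨d, h2⟩
  symm := by
    constructor
    rintro a b ⟨h1, h2⟩
    exact ⟨h1.symm, by rwa [Sym2.eq_swap]⟩

lemma overlap_edges {n : ℕ} (f g : V → Fin n) (hf : Function.Injective f)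
    (hg : Function.Injective g) :
    (overlap H f g hf).edgeSet.ncard = (eS H f ∩ eS H g).card := by
  rw [← Set.ncard_image_of_injective _ (Sym2.map.injective hg), ← Set.ncard_coe_finset]
  congr 1
  ext e
  simp only [Set.mem_image, Finset.coe_inter, Set.mem_inter_iff, Finset.mem_coe]
  constructor
  · rintro ⟨x, hx, rfl⟩
    induction x with
    | h a b =>
      have hx' : H.Adj a b ∧ s(g a, g b) ∈ eS H f := hx
      exact ⟨hx'.2, (mem_eS H g _).2 ⟨a, b, hx'.1, rfl⟩⟩
  · rintro ⟨h1, h2⟩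
    obtain ⟨a, b, hab, rfl⟩ := (mem_eS H g _).1 h2
    exact ⟨s(a, b), ⟨hab, h1⟩, rfl⟩

lemma sum_overlap [DecidableEq V] {n : ℕ} (x : V) (v : Fin n) (f : V → Fin n) (hfx : f x = v) :
    ∑ g ∈ Finset.univ.filter (fun g : V → Fin n => Function.Injective g ∧ g x = v),
      (n : ℝ) ^ (Set.ncard {y | g y ∈ Set.range f} - 1)
      ≤ (((Fintype.card V : ℝ) + 1) * n) ^ (Fintype.card V - 1) := by
  classical
  set c : V → Fin n → ℝ := fun y z => if y = x then 1 else if z ∈ Set.range f then (n : ℝ) else 1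
    with hc
  set t : V → Finset (Fin n) := fun y => if y = x then {v} else Finset.univ with ht
  have hn1 : (1 : ℝ) ≤ n := by exact_mod_cast v.pos
  have hc0 : ∀ y z, 0 ≤ c y z := by
    intro y z
    simp only [hc]
    split_ifs <;> linarith
  have e1 : ∀ g ∈ Finset.univ.filter (fun g : V → Fin n => Function.Injective g ∧ g x = v),
      (n : ℝ) ^ (Set.ncard {y | g y ∈ Set.range f} - 1) = ∏ y, c y (g y) := by
    intro g hg
    have hgx := (Finset.mem_filter.1 hg).2.2
    rw [← Finset.mul_prod_erase _ _ (Finset.mem_univ x)]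
    have : c x (g x) = 1 := by simp [hc]
    rw [this, one_mul]
    have h2 : ∏ y ∈ Finset.univ.erase x, c y (g y)
        = ∏ y ∈ Finset.univ.erase x, if g y ∈ Set.range f then (n : ℝ) else 1 := by
      refine Finset.prod_congr rfl fun y hy => ?_
      simp [hc, (Finset.mem_erase.1 hy).1]
    rw [h2, Finset.prod_ite, Finset.prod_const, Finset.prod_const_one, mul_one]
    congr 1
    rw [Finset.filter_erase, Finset.card_erase_of_mem, ← Set.ncard_coe_finset]
    · congr 2
      ext y
      simp
    · simp only [Finset.mem_filter, Finset.mem_univ, true_and]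
      exact ⟨x, by rw [hfx, hgx]⟩
  rw [Finset.sum_congr rfl e1]
  have hsub : Finset.univ.filter (fun g : V → Fin n => Function.Injective g ∧ g x = v)
      ⊆ Fintype.piFinset t := by
    intro g hg
    have hgx := (Finset.mem_filter.1 hg).2.2
    rw [Fintype.mem_piFinset]
    intro y
    by_cases hy : y = x
    · subst hy; simp [ht, hgx]
    · simp [ht, hy]
  refine (Finset.sum_le_sum_of_subset_of_nonneg hsub
    (fun g _ _ => Finset.prod_nonneg fun y _ => hc0 y _)).trans ?_
  rw [← Finset.prod_univ_sum, ← Finset.mul_prod_erase _ _ (Finset.mem_univ x)]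
  have : ∑ z ∈ t x, c x z = 1 := by simp [ht, hc]
  rw [this, one_mul]
  have hcard : (Finset.univ.erase x : Finset V).card = Fintype.card V - 1 := by
    rw [Finset.card_erase_of_mem (Finset.mem_univ x), Finset.card_univ]
  rw [← hcard, ← Finset.prod_const]
  refine Finset.prod_le_prod (fun y _ => Finset.sum_nonneg fun z _ => hc0 y z) fun y hy => ?_
  have hyx := (Finset.mem_erase.1 hy).1
  have e3 : ∑ z ∈ t y, c y z = ∑ z : Fin n, if z ∈ Set.range f then (n : ℝ) else 1 := by
    simp [ht, hc, hyx]
  rw [e3]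
  have e4 : ∑ z : Fin n, (if z ∈ Set.range f then (n : ℝ) else 1)
      ≤ ∑ z : Fin n, ((if z ∈ Finset.univ.image f then (n : ℝ) else 0) + 1) := by
    refine Finset.sum_le_sum fun z _ => ?_
    have : z ∈ Finset.univ.image f ↔ z ∈ Set.range f := by simp
    by_cases hz : z ∈ Set.range f
    · rw [if_pos hz, if_pos (this.2 hz)]; linarith
    · rw [if_neg hz, if_neg (fun h => hz (this.1 h))]; linarith
  refine e4.trans ?_
  rw [Finset.sum_add_distrib, Finset.sum_ite_mem, Finset.univ_inter, Finset.sum_const,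
    Finset.sum_const, Finset.card_univ, Fintype.card_fin, nsmul_eq_mul, nsmul_eq_mul, mul_one]
  have h5 : ((Finset.univ.image f).card : ℝ) ≤ Fintype.card V := by
    exact_mod_cast Finset.card_image_le
  nlinarith

lemma overlap_term {n : ℕ} {p : ℝ} (h0 : 0 ≤ p) {L : ℝ}
    (hL : ∀ J : H.Subgraph, 1 < J.verts.ncard →
      L ≤ (n : ℝ) ^ (J.verts.ncard - 1) * p ^ J.edgeSet.ncard)
    (f g : V → Fin n) (hf : Function.Injective f) (hg : Function.Injective g)
    (hd : ¬ Disjoint (eS H f) (eS H g)) :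
    p ^ (eS H f ∪ eS H g).card * L
      ≤ (p ^ H.edgeSet.ncard) ^ 2 * (n : ℝ) ^ (Set.ncard {y | g y ∈ Set.range f} - 1) := by
  have hv : 1 < (overlap H f g hf).verts.ncard := by
    rw [Finset.not_disjoint_iff] at hd
    obtain ⟨e, h1, h2⟩ := hd
    obtain ⟨a, b, hab, rfl⟩ := (mem_eS H g _).1 h2
    have hJ : (overlap H f g hf).Adj a b := ⟨hab, h1⟩
    rw [Set.one_lt_ncard]
    exact ⟨a, hJ.fst_mem, b, hJ.snd_mem, hab.ne⟩
  have h := hL _ hv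
  rw [overlap_edges H f g hf hg] at h
  have h2 := mul_le_mul_of_nonneg_left h (pow_nonneg h0 (eS H f ∪ eS H g).card)
  refine h2.trans (le_of_eq ?_)
  have hc := Finset.card_union_add_card_inter (eS H f) (eS H g)
  rw [card_eS H f hf, card_eS H g hg] at hc
  have : p ^ (eS H f ∪ eS H g).card * p ^ (eS H f ∩ eS H g).card = (p ^ H.edgeSet.ncard) ^ 2 := by
    rw [← pow_add, hc, ← pow_mul, mul_two]
  change p ^ (eS H f ∪ eS H g).card * ((n : ℝ) ^ (Set.ncard {y | g y ∈ Set.range f} - 1)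
    * p ^ (eS H f ∩ eS H g).card) = _
  rw [← this]
  ring

lemma one_vertex {n : ℕ} {p : ℝ} (h0 : 0 < p) (h1 : p ≤ 1) {L : ℝ} (hLpos : 0 < L)
    (hL : ∀ J : H.Subgraph, 1 < J.verts.ncard →
      L ≤ (n : ℝ) ^ (J.verts.ncard - 1) * p ^ J.edgeSet.ncard)
    [DecidableEq V] (hn : 2 * Fintype.card V ≤ n) (x : V) (v : Fin n) :
    ex p (fun ω => ∏ f ∈ Finset.univ.filter
        (fun f : V → Fin n => Function.Injective f ∧ f x = v), (1 - ind (eS H f) ω))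
      ≤ Real.exp (-(L / (2 * (4 * ((Fintype.card V : ℝ) + 1)) ^ (Fintype.card V - 1)))) := by
  classical
  set k := Fintype.card V with hk
  set A := Finset.univ.filter (fun f : V → Fin n => Function.Injective f ∧ f x = v) with hA
  have hinj : ∀ f ∈ A, Function.Injective f := fun f hf => (Finset.mem_filter.1 hf).2.1
  have hroot : ∀ f ∈ A, f x = v := fun f hf => (Finset.mem_filter.1 hf).2.2
  set P := p ^ H.edgeSet.ncard with hP
  have hP0 : 0 < P := pow_pos h0 _
  have hn0 : (0 : ℝ) < n := by exact_mod_cast v.pos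
  set Q : ℝ := (n : ℝ) ^ (k - 1) with hQ
  have hQ0 : 0 < Q := pow_pos hn0 _
  set K : ℝ := ((k : ℝ) + 1) ^ (k - 1) with hK
  have hK0 : 0 < K := by positivity
  set D : ℝ := (Q * P) ^ 2 * K / L with hD
  have hD0 : 0 < D := by positivity
  have hsum : ∑ f ∈ A, ∑ g ∈ A with ¬ Disjoint (eS H f) (eS H g),
      p ^ (eS H f ∪ eS H g).card ≤ D := by
    have inner : ∀ f ∈ A, ∑ g ∈ A with ¬ Disjoint (eS H f) (eS H g),
        p ^ (eS H f ∪ eS H g).card ≤ P ^ 2 / L * (K * Q) := by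
      intro f hf
      have s1 : ∑ g ∈ A with ¬ Disjoint (eS H f) (eS H g), p ^ (eS H f ∪ eS H g).card
          ≤ ∑ g ∈ A with ¬ Disjoint (eS H f) (eS H g),
            P ^ 2 / L * (n : ℝ) ^ (Set.ncard {y | g y ∈ Set.range f} - 1) := by
        refine Finset.sum_le_sum fun g hg => ?_
        obtain ⟨hgA, hd⟩ := Finset.mem_filter.1 hg
        have := overlap_term H h0.le hL f g (hinj f hf) (hinj g hgA) hd
        rw [div_mul_eq_mul_div, le_div_iff₀ hLpos]
        exact this
      refine s1.trans ?_
      refine (Finset.sum_le_sum_of_subset_of_nonneg (Finset.filter_subset _ _)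
        (fun g _ _ => by positivity)).trans ?_
      rw [← Finset.mul_sum]
      refine mul_le_mul_of_nonneg_left ?_ (by positivity)
      refine (sum_overlap x v f (hroot f hf)).trans (le_of_eq ?_)
      rw [mul_pow]
    refine (Finset.sum_le_sum inner).trans ?_
    rw [Finset.sum_const, nsmul_eq_mul]
    have hAc : (A.card : ℝ) ≤ Q := by
      have : A.card ≤ n ^ (k - 1) := by
        rw [hk, ← card_root x v]
        refine Finset.card_le_card fun f hf => ?_
        simpa using hroot f hf
      simp only [hQ]
      exact_mod_cast this
    refine (mul_le_mul_of_nonneg_right hAc (by positivity)).trans (le_of_eq ?_)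
    simp only [hD]
    ring
  have hμ : Q * P / 2 ^ (k - 1) ≤ ∑ f ∈ A, p ^ (eS H f).card := by
    have : ∀ f ∈ A, p ^ (eS H f).card = P := fun f hf => by rw [card_eS H f (hinj f hf)]
    rw [Finset.sum_congr rfl this, Finset.sum_const, nsmul_eq_mul]
    have h2 := rooted_lower x v
    have h3 : ((n : ℝ) / 2) ^ (k - 1) ≤ A.card := by
      have h4 : (((n - (k - 1) : ℕ) : ℝ)) ^ (k - 1) ≤ A.card := by exact_mod_cast h2
      refine le_trans (pow_le_pow_left₀ (by positivity) ?_ _) h4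
      rw [div_le_iff₀ (by norm_num)]
      have : n ≤ (n - (k - 1)) * 2 := by omega
      exact_mod_cast this
    rw [div_pow] at h3
    have := mul_le_mul_of_nonneg_right h3 hP0.le
    refine le_trans (le_of_eq ?_) this
    ring
  set m := Q * P / 2 ^ (k - 1) with hm
  have hm0 : 0 < m := by positivity
  have hJ := janson h0.le h1 A (eS H) hsum (t := m / D) (by positivity)
  refine hJ.trans (Real.exp_le_exp.2 ?_)
  have h5 : m / D * m ≤ m / D * ∑ f ∈ A, p ^ (eS H f).card :=
    mul_le_mul_of_nonneg_left hμ (by positivity)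
  have h6 : (m / D) ^ 2 * D / 2 = m / D * m / 2 := by field_simp
  have h7 : m / D * m / 2 = L / (2 * (4 * ((k : ℝ) + 1)) ^ (k - 1)) := by
    have h4 : (4 : ℝ) ^ (k - 1) = (2 ^ (k - 1)) ^ 2 := by
      rw [← pow_mul, mul_comm, pow_mul]; norm_num
    rw [mul_pow, h4, ← hK]
    simp only [hm, hD]
    field_simp
  rw [h6]
  linarith

lemma one_bound {n : ℕ} {p : ℝ} (h0 : 0 < p) (h1 : p ≤ 1) {L : ℝ} (hLpos : 0 < L)
    (hL : ∀ J : H.Subgraph, 1 < J.verts.ncard →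
      L ≤ (n : ℝ) ^ (J.verts.ncard - 1) * p ^ J.edgeSet.ncard)
    (hn : 2 * Fintype.card V ≤ n) (x : V) :
    1 - n * Real.exp (-(L / (2 * (4 * ((Fintype.card V : ℝ) + 1)) ^ (Fintype.card V - 1))))
      ≤ ex p ((covSet H n).indicator fun _ => 1) := by
  classical
  set U : Fin n → (Sym2 (Fin n) → Bool) → ℝ := fun v ω => ∏ f ∈ Finset.univ.filter
        (fun f : V → Fin n => Function.Injective f ∧ f x = v), (1 - ind (eS H f) ω) with hU
  have hU0 : ∀ v ω, 0 ≤ U v ω := fun v ω =>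
    Finset.prod_nonneg fun f _ => sub_nonneg.2 (ind_le_one _ _)
  have point : ∀ ω, 1 - ∑ v, U v ω ≤ (covSet H n).indicator (fun _ => (1 : ℝ)) ω := by
    intro ω
    by_cases hω : ω ∈ covSet H n
    · rw [Set.indicator_of_mem hω]
      have : 0 ≤ ∑ v, U v ω := Finset.sum_nonneg fun v _ => hU0 v ω
      linarith
    · rw [Set.indicator_of_notMem hω]
      rw [mem_covSet] at hω
      push Not at hω
      obtain ⟨v, hv⟩ := hω
      have h2 : U v ω = 1 := by
        refine Finset.prod_eq_one fun f hf => ?_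
        obtain ⟨hf1, hf2⟩ := (Finset.mem_filter.1 hf).2
        have : ind (eS H f) ω ≠ 1 := fun h => hv f hf1 h x hf2
        have : ind (eS H f) ω = 0 := by
          unfold ind at this ⊢
          split_ifs at this ⊢ with h
          · exact absurd rfl this
          · rfl
        rw [this, sub_zero]
      have := Finset.single_le_sum (f := fun v => U v ω) (fun v _ => hU0 v ω) (Finset.mem_univ v)
      simp only [h2] at this
      linarith
  refine le_trans ?_ (ex_mono h0.le h1 point)
  rw [ex_sub, ex_one, ex_sum]
  have := Finset.sum_le_sum (s := (Finset.univ : Finset (Fin n)))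
    fun v _ => one_vertex H h0 h1 hLpos hL hn x v
  rw [Finset.sum_const, Finset.card_univ, Fintype.card_fin, nsmul_eq_mul] at this
  linarith

end OnePart

section Final

variable {V : Type} [Fintype V] (H : SimpleGraph V)

lemma top_verts : (⊤ : H.Subgraph).verts.ncard = Fintype.card V := by
  simp [Set.ncard_univ]

lemma top_edges : (⊤ : H.Subgraph).edgeSet.ncard = H.edgeSet.ncard := by
  simp

lemma m1_eq (hV : 2 ≤ Fintype.card V) (hbal : StrictlyOneBalanced H) :
    m1 H = (H.edgeSet.ncard : ℝ) / ((Fintype.card V : ℝ) - 1) := by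
  unfold m1
  apply IsGreatest.csSup_eq
  constructor
  · refine ⟨⊤, ?_, ?_⟩
    · rw [top_verts]; omega
    · rw [top_verts, top_edges]
  · rintro x ⟨J, hJ, rfl⟩
    by_cases h : J = ⊤
    · subst h
      rw [top_verts, top_edges]
    · exact (hbal J hJ h).le

lemma no_isolated (hV : 2 ≤ Fintype.card V) (hE : H.edgeSet.Nonempty)
    (hbal : StrictlyOneBalanced H) (x : V) : ∃ y, H.Adj x y := by
  by_contra hx
  push Not at hx
  let J : H.Subgraph :=
    { verts := {x}ᶜ
      Adj := H.Adj
      adj_sub := fun h => h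
      edge_vert := by
        rintro a b hab
        simp only [Set.mem_compl_iff, Set.mem_singleton_iff]
        rintro rfl
        exact hx b hab
      symm := H.symm }
  have hJe : J.edgeSet = H.edgeSet := by
    ext e
    induction e with
    | h a b => rfl
  have hJv : J.verts.ncard = Fintype.card V - 1 := by
    change ({x}ᶜ : Set V).ncard = _
    rw [Set.ncard_compl, Set.ncard_singleton, Nat.card_eq_fintype_card]
  have hJ1 : 1 < J.verts.ncard := by
    obtain ⟨e, he⟩ := hE
    induction e with
    | h a b =>
      have hab : J.Adj a b := he
      rw [Set.one_lt_ncard]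
      exact ⟨a, hab.fst_mem, b, hab.snd_mem, hab.ne⟩
  have hJt : J ≠ ⊤ := by
    intro h
    have := top_verts H
    rw [← h, hJv] at this
    omega
  have h := hbal J hJ1 hJt
  have he : 0 < H.edgeSet.ncard := (Set.ncard_pos H.edgeSet.toFinite).2 hE
  rw [hJe, hJv] at h
  rw [hJv] at hJ1
  have h2 : (1 : ℝ) < ((Fintype.card V - 1 : ℕ) : ℝ) := by exact_mod_cast hJ1
  have h3 : ((Fintype.card V - 1 : ℕ) : ℝ) ≤ (Fintype.card V : ℝ) := by exact_mod_cast Nat.sub_le _ _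
  have h4 : (H.edgeSet.ncard : ℝ) / ((Fintype.card V : ℝ) - 1)
      ≤ (H.edgeSet.ncard : ℝ) / (((Fintype.card V - 1 : ℕ) : ℝ) - 1) :=
    div_le_div_of_nonneg_left (by positivity) (by linarith) (by linarith)
  linarith

lemma ratio_pow (hV : 2 ≤ Fintype.card V) (hE : H.edgeSet.Nonempty)
    (hbal : StrictlyOneBalanced H) (p : ℝ) (n : ℕ) (hn : 2 ≤ n) :
    (p * (n : ℝ) ^ (1 / m1 H) / Real.log n ^ (1 / (H.edgeSet.ncard : ℝ))) ^ H.edgeSet.ncard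
      = (n : ℝ) ^ (Fintype.card V - 1) * p ^ H.edgeSet.ncard / Real.log n := by
  have he : 0 < H.edgeSet.ncard := (Set.ncard_pos H.edgeSet.toFinite).2 hE
  have he' : (H.edgeSet.ncard : ℝ) ≠ 0 := by positivity
  have hlog : 0 ≤ Real.log n := Real.log_natCast_nonneg n
  rw [div_pow, mul_pow, m1_eq H hV hbal, ← Real.rpow_natCast (_ ^ (1 / _)) (H.edgeSet.ncard),
    ← Real.rpow_mul (by positivity), ← Real.rpow_natCast (Real.log n ^ _) (H.edgeSet.ncard),
    ← Real.rpow_mul hlog]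
  have e1 : 1 / ((H.edgeSet.ncard : ℝ) / ((Fintype.card V : ℝ) - 1)) * H.edgeSet.ncard
      = ((Fintype.card V - 1 : ℕ) : ℝ) := by
    rw [Nat.cast_sub (by omega)]
    push_cast
    rw [one_div_div]
    field_simp
  have e2 : 1 / (H.edgeSet.ncard : ℝ) * H.edgeSet.ncard = 1 := by field_simp
  rw [e1, e2, Real.rpow_one, Real.rpow_natCast]
  ring

lemma cov_ex_le_one (n : ℕ) {p : ℝ} (h0 : 0 ≤ p) (h1 : p ≤ 1) :
    ex p ((covSet H n).indicator fun _ => 1) ≤ 1 := by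
  refine (ex_mono h0 h1 (g := fun _ => 1) fun ω => ?_).trans (ex_one p).le
  exact Set.indicator_le_self' (fun _ _ => zero_le_one) ω

lemma cov_ex_nonneg (n : ℕ) {p : ℝ} (h0 : 0 ≤ p) (h1 : p ≤ 1) :
    0 ≤ ex p ((covSet H n).indicator fun _ => 1) :=
  ex_nonneg h0 h1 fun ω => Set.indicator_nonneg (fun _ _ => zero_le_one) ω

lemma zero_part (hV : 2 ≤ Fintype.card V) (hE : H.edgeSet.Nonempty)
    (hbal : StrictlyOneBalanced H) (p : ℕ → ℝ) (hp : ∀ n, 0 ≤ p n ∧ p n ≤ 1)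
    (hM : Tendsto (fun n : ℕ => (n : ℝ) ^ (Fintype.card V - 1) * p n ^ H.edgeSet.ncard
      / Real.log n) atTop (𝓝 0)) :
    Tendsto (fun n : ℕ => ex (p n) ((covSet H n).indicator fun _ => 1)) atTop (𝓝 0) := by
  set k := Fintype.card V with hk
  set e := H.edgeSet.ncard with he
  have hlogo : Tendsto (fun n : ℕ => Real.log n / (n : ℝ) ^ ((1 : ℝ) / 3)) atTop (𝓝 0) :=
    ((isLittleO_log_rpow_atTop (by norm_num : (0 : ℝ) < 1 / 3)).tendsto_div_nhds_zero).comp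
      tendsto_natCast_atTop_atTop
  have hlog1 : Tendsto (fun n : ℕ => Real.log n / (n : ℝ)) atTop (𝓝 0) :=
    (Real.isLittleO_log_id_atTop.tendsto_div_nhds_zero).comp tendsto_natCast_atTop_atTop
  have hhalf : ∀ᶠ n : ℕ in atTop, p n ≤ 1 / 2 := by
    have hpos : (0 : ℝ) < (1 / 2) ^ e := by positivity
    filter_upwards [hM.eventually_lt_const one_pos, hlog1.eventually_lt_const hpos,
      eventually_ge_atTop 2] with n h1 h2 hn
    by_contra hlt
    push Not at hlt
    have hn2 : (2 : ℝ) ≤ n := by exact_mod_cast hn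
    have hlogpos : 0 < Real.log n := Real.log_pos (by linarith)
    rw [div_lt_one hlogpos] at h1
    rw [div_lt_iff₀ (by linarith)] at h2
    have h3 : (1 / 2 : ℝ) ^ e ≤ p n ^ e := pow_le_pow_left₀ (by norm_num) hlt.le _
    have h4 : (n : ℝ) ≤ (n : ℝ) ^ (k - 1) := le_self_pow₀ (by linarith) (by omega)
    have h5 : (1 / 2 : ℝ) ^ e * n ≤ (n : ℝ) ^ (k - 1) * p n ^ e := by
      rw [mul_comm]
      exact mul_le_mul h4 h3 (by positivity) (by positivity)
    linarith
  have hexp : Tendsto (fun n : ℕ => Real.exp (-((n : ℝ) ^ ((1 : ℝ) / 6) - 1))) atTop (𝓝 0) := by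
    refine Real.tendsto_exp_neg_atTop_nhds_zero.comp ?_
    refine tendsto_atTop_add_const_right _ (-1) ?_
    exact (tendsto_rpow_atTop (by norm_num)).comp tendsto_natCast_atTop_atTop
  set M : ℕ → ℝ := fun n => (n : ℝ) ^ (k - 1) * p n ^ e / Real.log n with hMdef
  have hB : Tendsto (fun n : ℕ => (k : ℝ) ^ 2 * (M n * (Real.log n / (n : ℝ) ^ ((1 : ℝ) / 3)))
      + 12 * k * M n + Real.exp (-((n : ℝ) ^ ((1 : ℝ) / 6) - 1))) atTop (𝓝 0) := by
    have := (((hM.mul hlogo).const_mul ((k : ℝ) ^ 2)).add (hM.const_mul (12 * (k : ℝ)))).add hexp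
    simpa using this
  refine tendsto_of_tendsto_of_tendsto_of_le_of_le' tendsto_const_nhds hB
    (Eventually.of_forall fun n => cov_ex_nonneg H n (hp n).1 (hp n).2) ?_
  filter_upwards [hhalf, eventually_ge_atTop 2] with n hph hn
  have hn2 : (2 : ℝ) ≤ n := by exact_mod_cast hn
  have hn0 : (0 : ℝ) < n := by linarith
  have hlogpos : 0 < Real.log n := Real.log_pos (by linarith)
  set y : ℝ := (n : ℝ) ^ ((1 : ℝ) / 3) with hy
  have hy1 : 1 ≤ y := Real.one_le_rpow (by linarith) (by norm_num)
  have hyn : y ≤ n := by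
    have := Real.rpow_le_rpow_of_exponent_le (by linarith : (1 : ℝ) ≤ n) (by norm_num : (1 : ℝ) / 3 ≤ 1)
    rwa [Real.rpow_one] at this
  have hy3 : y ^ 3 = n := by
    rw [hy, ← Real.rpow_natCast, ← Real.rpow_mul hn0.le]
    norm_num
  have hsn : ⌊y⌋₊ ≤ (Finset.univ : Finset (Fin n)).card := by
    rw [Finset.card_univ, Fintype.card_fin]
    exact Nat.floor_le_of_le hyn
  obtain ⟨T, -, hT⟩ := Finset.exists_subset_card_eq hsn
  have hs1 : 1 ≤ ⌊y⌋₊ := (Nat.one_le_floor_iff y).2 hy1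
  have hTne : T.Nonempty := Finset.card_pos.1 (by omega)
  have hsy : (T.card : ℝ) ≤ y := by rw [hT]; exact Nat.floor_le (by linarith)
  have hsy' : y - 1 ≤ (T.card : ℝ) := by rw [hT]; exact (Nat.sub_one_lt_floor y).le
  have hmain := zero_bound H (no_isolated H hV hE hbal) (hp n).1 hph T hTne
    (t := Real.log n / 12) (by positivity)
  refine hmain.trans ?_
  have hpe : 0 ≤ p n ^ e := pow_nonneg (hp n).1 _
  refine add_le_add (add_le_add ?_ ?_) ?_
  · rw [← hk, ← he, mul_assoc]
    refine mul_le_mul_of_nonneg_left ?_ (by positivity)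
    have e1 : M n * (Real.log n / y) = (n : ℝ) ^ (k - 1) * p n ^ e / y := by
      simp only [hMdef]
      field_simp
    rw [e1, le_div_iff₀ (by linarith)]
    have e2 : (n : ℝ) ^ (k - 1) = n ^ (k - 2) * n := by
      rw [← pow_succ]; congr 1; omega
    rw [e2]
    have e3 : (T.card : ℝ) ^ 2 * y ≤ n := by
      rw [← hy3, pow_succ y 2]
      exact mul_le_mul_of_nonneg_right (pow_le_pow_left₀ (by positivity) hsy 2) (by linarith)
    have e4 : 0 ≤ (n : ℝ) ^ (k - 2) * p n ^ e := by positivity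
    nlinarith [mul_le_mul_of_nonneg_left e3 e4]
  · apply le_of_eq
    rw [← hk, ← he]
    simp only [hMdef]
    field_simp
  · apply Real.exp_le_exp.2
    apply neg_le_neg
    have e1 : Real.exp (-(2 * (Real.log n / 12))) = (n : ℝ) ^ (-((1 : ℝ) / 6)) := by
      rw [Real.rpow_def_of_pos hn0]
      congr 1
      ring
    rw [e1]
    have e2 : y * (n : ℝ) ^ (-((1 : ℝ) / 6)) = (n : ℝ) ^ ((1 : ℝ) / 6) := by
      rw [hy, ← Real.rpow_add hn0]
      norm_num
    have e3 : (n : ℝ) ^ (-((1 : ℝ) / 6)) ≤ 1 :=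
      Real.rpow_le_one_of_one_le_of_nonpos (by linarith) (by norm_num)
    have e4 : 0 ≤ (n : ℝ) ^ (-((1 : ℝ) / 6)) := by positivity
    have := mul_le_mul_of_nonneg_right hsy' e4
    linarith

lemma one_part (hV : 2 ≤ Fintype.card V) (hE : H.edgeSet.Nonempty)
    (hbal : StrictlyOneBalanced H) (p : ℕ → ℝ) (hp : ∀ n, 0 ≤ p n ∧ p n ≤ 1)
    (hM : Tendsto (fun n : ℕ => (n : ℝ) ^ (Fintype.card V - 1) * p n ^ H.edgeSet.ncard
      / Real.log n) atTop atTop) :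
    Tendsto (fun n : ℕ => ex (p n) ((covSet H n).indicator fun _ => 1)) atTop (𝓝 1) := by
  have he0 : 0 < H.edgeSet.ncard := (Set.ncard_pos H.edgeSet.toFinite).2 hE
  set k := Fintype.card V with hk
  set e := H.edgeSet.ncard with he
  set c : ℝ := 2 * (4 * ((k : ℝ) + 1)) ^ (k - 1) with hc
  have hc0 : 0 < c := by positivity
  obtain ⟨x⟩ : Nonempty V := Fintype.card_pos_iff.1 (by omega)
  have hlogp : Tendsto (fun n : ℕ => Real.log n ^ e / (n : ℝ)) atTop (𝓝 0) :=
    ((Real.isLittleO_pow_log_id_atTop (n := e)).tendsto_div_nhds_zero).comp tendsto_natCast_atTop_atTop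
  have hB : Tendsto (fun n : ℕ => 1 - 1 / (n : ℝ)) atTop (𝓝 1) := by
    have := (tendsto_one_div_atTop_nhds_zero_nat (𝕜 := ℝ)).const_sub 1
    simpa using this
  refine tendsto_of_tendsto_of_tendsto_of_le_of_le' hB tendsto_const_nhds ?_
    (Eventually.of_forall fun n => cov_ex_le_one H n (hp n).1 (hp n).2)
  have hcpos : 0 < ((2 * c) ^ e)⁻¹ := by positivity
  filter_upwards [hM.eventually_ge_atTop (2 * c), hlogp.eventually_lt_const hcpos,
    eventually_ge_atTop (2 * k), eventually_ge_atTop 3] with n hMn hl hn hn3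
  have hn3' : (3 : ℝ) ≤ n := by exact_mod_cast hn3
  have hn0 : (0 : ℝ) < n := by linarith
  have hlog1 : 1 ≤ Real.log n := by
    rw [Real.le_log_iff_exp_le hn0]
    linarith [Real.exp_one_lt_d9]
  have hlogpos : 0 < Real.log n := by linarith
  rw [le_div_iff₀ hlogpos] at hMn
  have hc1 : 1 ≤ 2 * c := by
    have : (1 : ℝ) ≤ (4 * ((k : ℝ) + 1)) ^ (k - 1) :=
      one_le_pow₀ (by have : (0 : ℝ) ≤ k := by positivity
                      linarith)
    linarith
  have hL1 : 1 ≤ 2 * c * Real.log n := by nlinarith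
  have hM1 : 1 ≤ (n : ℝ) ^ (k - 1) * p n ^ e := hL1.trans hMn
  have hp0 : 0 < p n := by
    rcases (hp n).1.eq_or_lt with h | h
    · rw [← h, zero_pow (by omega)] at hM1
      norm_num at hM1
    · exact h
  have hLe : (2 * c * Real.log n) ^ e ≤ n := by
    rw [div_lt_iff₀ hn0, ← div_eq_inv_mul, lt_div_iff₀ (by positivity)] at hl
    rw [mul_pow, mul_comm]
    exact hl.le
  have key := one_bound H hp0 (hp n).2 (L := 2 * c * Real.log n) (by positivity) ?_ hn x
  · refine le_trans (le_of_eq ?_) key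
    rw [← hk, ← hc]
    have : 2 * c * Real.log n / c = Real.log n + Real.log n := by field_simp; ring
    rw [this, neg_add, Real.exp_add, Real.exp_neg, Real.exp_log hn0]
    field_simp
  · intro J hJ
    by_cases hJt : J = ⊤
    · subst hJt
      rw [top_verts, top_edges]
      exact hMn
    · have hb := hbal J hJ hJt
      have hj : (1 : ℝ) < J.verts.ncard := by exact_mod_cast hJ
      have hk2 : (2 : ℝ) ≤ k := by exact_mod_cast hV
      rw [div_lt_div_iff₀ (by linarith) (by linarith)] at hb
      have hnat : J.edgeSet.ncard * (k - 1) + 1 ≤ (J.verts.ncard - 1) * e := by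
        have : ((J.edgeSet.ncard * (k - 1) : ℕ) : ℝ) < (((J.verts.ncard - 1) * e : ℕ) : ℝ) := by
          push_cast [Nat.cast_sub hJ.le, Nat.cast_sub (by omega : 1 ≤ k)]
          linarith
        exact_mod_cast this
      refine le_of_pow_le_pow_left₀ he0.ne' (by positivity) (hLe.trans ?_)
      rw [mul_pow, ← pow_mul, ← pow_mul]
      have h1 : (n : ℝ) ^ (J.edgeSet.ncard * (k - 1) + 1) ≤ (n : ℝ) ^ ((J.verts.ncard - 1) * e) :=
        pow_le_pow_right₀ (by linarith) hnat
      have h2 : (n : ℝ) ≤ (n : ℝ) ^ (J.edgeSet.ncard * (k - 1) + 1) * p n ^ (J.edgeSet.ncard * e) := by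
        have : (n : ℝ) ^ (J.edgeSet.ncard * (k - 1) + 1) * p n ^ (J.edgeSet.ncard * e)
            = ((n : ℝ) ^ (k - 1) * p n ^ e) ^ J.edgeSet.ncard * n := by
          rw [mul_pow, ← pow_mul, ← pow_mul, pow_succ, mul_comm (k - 1), mul_comm e]
          ring
        rw [this]
        have := one_le_pow₀ hM1 (n := J.edgeSet.ncard)
        nlinarith
      exact h2.trans (mul_le_mul_of_nonneg_right h1 (by positivity))

end Final


/-- **Threshold for every vertex to be covered by a copy of `H`** (Ruciński, Spencer).
For a strictly 1-balanced graph `H` with at least 2 vertices and at least one edge,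
`(log n)^{1/e(H)} / n^{1/m₁(H)}` is a threshold for the event `COV_H` that every vertex of
`G(n,p)` lies in a copy of `H`. -/
theorem stmt_1 {V : Type} [Fintype V] (H : SimpleGraph V)
    (hV : 2 ≤ Fintype.card V) (hE : H.edgeSet.Nonempty) (hbal : StrictlyOneBalanced H)
    (p : ℕ → ℝ) (hp : ∀ n, 0 ≤ p n ∧ p n ≤ 1) :
    (Tendsto (fun n : ℕ =>
        p n * (n : ℝ) ^ (1 / m1 H) / Real.log n ^ (1 / (H.edgeSet.ncard : ℝ)))
        atTop (𝓝 0) →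
      Tendsto (fun n : ℕ => gnp n (p n)
        {ω | ∀ v : Fin n, ∃ f : V → Fin n, Function.Injective f ∧
          (∀ ⦃a b⦄, H.Adj a b → (graphOf ω).Adj (f a) (f b)) ∧ ∃ x, f x = v})
        atTop (𝓝 0)) ∧
    (Tendsto (fun n : ℕ =>
        p n * (n : ℝ) ^ (1 / m1 H) / Real.log n ^ (1 / (H.edgeSet.ncard : ℝ)))
        atTop atTop →
      Tendsto (fun n : ℕ => gnp n (p n)
        {ω | ∀ v : Fin n, ∃ f : V → Fin n, Function.Injective f ∧
          (∀ ⦃a b⦄, H.Adj a b → (graphOf ω).Adj (f a) (f b)) ∧ ∃ x, f x = v})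
        atTop (𝓝 1)) := by
  have he : 0 < H.edgeSet.ncard := (Set.ncard_pos H.edgeSet.toFinite).2 hE
  have hg : ∀ n : ℕ, gnp n (p n)
      {ω | ∀ v : Fin n, ∃ f : V → Fin n, Function.Injective f ∧
          (∀ ⦃a b⦄, H.Adj a b → (graphOf ω).Adj (f a) (f b)) ∧ ∃ x, f x = v}
      = ENNReal.ofReal (ex (p n) ((covSet H n).indicator fun _ => 1)) :=
    fun n => gnp_apply n (hp n).1 (hp n).2 (covSet H n)
  simp_rw [hg]
  have hr : (fun n : ℕ => (p n * (n : ℝ) ^ (1 / m1 H)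
        / Real.log n ^ (1 / (H.edgeSet.ncard : ℝ))) ^ H.edgeSet.ncard)
      =ᶠ[atTop] fun n : ℕ => (n : ℝ) ^ (Fintype.card V - 1) * p n ^ H.edgeSet.ncard / Real.log n := by
    filter_upwards [eventually_ge_atTop 2] with n hn
    exact ratio_pow H hV hE hbal (p n) n hn
  constructor
  · intro h
    have h2 := h.pow H.edgeSet.ncard
    rw [zero_pow he.ne'] at h2
    have h3 := ENNReal.tendsto_ofReal (zero_part H hV hE hbal p hp (h2.congr' hr))
    simpa using h3
  · intro h
    have h2 := (tendsto_pow_atTop he.ne').comp h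
    have h3 := ENNReal.tendsto_ofReal (one_part H hV hE hbal p hp (h2.congr' hr))
    simpa using h3
end

section
/- For all 0 < a < 1 and every graph H with maximum degree Δ(H) ≥ 2 there is a constant c > 0 such that the following holds: if p ≤ c·n^{-1/m_2(H)}, then a.a.s. G(n,p) has a spanning subgraph G containing no copy of H with e(G) ≥ a·e(G(n,p)). -/
open MeasureTheory Filter Topology

instance bern_prob (p : ℝ) : IsProbabilityMeasure (bernoulliMeasure p) := by
  constructor
  simp [bernoulliMeasure]

instance gnp_prob (n : ℕ) (p : ℝ) : IsProbabilityMeasure (gnp n p) := by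
  unfold gnp; infer_instance

lemma bern_true {p : ℝ} (h1 : p ≤ 1) :
    bernoulliMeasure p {true} = ENNReal.ofReal p := by
  simp [bernoulliMeasure, h1]

lemma bern_integral {p : ℝ} (h0 : 0 ≤ p) (h1 : p ≤ 1) (g : Bool → ℝ) :
    ∫ x, g x ∂(bernoulliMeasure p) = p * g true + (1 - p) * g false := by
  have hm : min (ENNReal.ofReal p) 1 = ENNReal.ofReal p := by simp [h1]
  rw [bernoulliMeasure, hm, integral_add_measure, integral_smul_measure, integral_smul_measure]
  · rw [integral_dirac, integral_dirac, ENNReal.toReal_sub_of_le (by simpa using h1) (by simp)]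
    simp [ENNReal.toReal_ofReal h0]
  · exact (Integrable.of_finite).smul_measure (by simp)
  · exact (Integrable.of_finite).smul_measure (by simp)

lemma gnp_open {n : ℕ} {p : ℝ} (h0 : 0 ≤ p) (h1 : p ≤ 1) (F : Finset (Sym2 (Fin n))) :
    (gnp n p).real {ω | ∀ e ∈ F, ω e = true} = p ^ F.card := by
  classical
  have hs : {ω : Sym2 (Fin n) → Bool | ∀ e ∈ F, ω e = true} =
      Set.pi Set.univ (fun e => if e ∈ F then {true} else Set.univ) := by
    ext ω
    simp only [Set.mem_ofPred_eq, Set.mem_pi, Set.mem_univ, true_imp_iff]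
    refine forall_congr' fun e => ?_
    by_cases he : e ∈ F <;> simp [he]
  rw [Measure.real, hs, gnp, Measure.pi_pi]
  have : ∀ e : Sym2 (Fin n), bernoulliMeasure p (if e ∈ F then {true} else Set.univ) =
      if e ∈ F then ENNReal.ofReal p else 1 := by
    intro e
    by_cases he : e ∈ F
    · rw [if_pos he, if_pos he, bern_true h1]
    · rw [if_neg he, if_neg he, measure_univ]
  simp_rw [this]
  simp [Finset.prod_ite_mem, ENNReal.toReal_ofReal h0]

lemma gnp_chernoff {n : ℕ} {p : ℝ} (h0 : 0 ≤ p) (h1 : p ≤ 1) (D : Finset (Sym2 (Fin n)))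
    (t : ℝ) :
    (gnp n p).real {ω | ((D.filter fun e => ω e = true).card : ℝ) ≤ t} ≤
      Real.exp (t - p * D.card / 2) := by
  classical
  let g : Sym2 (Fin n) → Bool → ℝ := fun e b => if e ∈ D then (if b = true then 1/2 else 1) else 1
  have hg : ∀ e b, 0 ≤ g e b := by
    intro e b; simp only [g]; split_ifs <;> norm_num
  have hf : ∀ ω : Sym2 (Fin n) → Bool, ∏ e, g e (ω e) =
      (1/2 : ℝ) ^ (D.filter fun e => ω e = true).card := by
    intro ω
    simp only [g, Finset.prod_ite_mem, Finset.univ_inter]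
    rw [Finset.prod_ite]
    simp
  have hint : ∫ ω, ∏ e, g e (ω e) ∂(gnp n p) = (1 - p/2) ^ D.card := by
    rw [gnp, integral_fintype_prod_eq_prod]
    have : ∀ e, ∫ x, g e x ∂(bernoulliMeasure p) = if e ∈ D then 1 - p/2 else 1 := by
      intro e
      rw [bern_integral h0 h1]
      by_cases he : e ∈ D <;> simp [g, he]
      ring
    simp [this, Finset.prod_ite_mem]
  have hmk := mul_meas_ge_le_integral_of_nonneg (μ := gnp n p)
    (f := fun ω => ∏ e, g e (ω e))
    (Filter.Eventually.of_forall fun ω => Finset.prod_nonneg fun e _ => hg e _)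
    (Integrable.of_finite) (Real.exp (-t))
  rw [hint] at hmk
  have hsub : {ω : Sym2 (Fin n) → Bool | ((D.filter fun e => ω e = true).card : ℝ) ≤ t} ⊆
      {ω | Real.exp (-t) ≤ ∏ e, g e (ω e)} := by
    intro ω hω
    simp only [Set.mem_ofPred_eq] at hω ⊢
    rw [hf]
    calc Real.exp (-t) ≤ Real.exp (-((D.filter fun e => ω e = true).card : ℝ)) := by
          apply Real.exp_le_exp.2; linarith
      _ = (Real.exp (-1)) ^ (D.filter fun e => ω e = true).card := by
          rw [← Real.exp_nat_mul]; ring_nf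
      _ ≤ _ := by
          apply pow_le_pow_left₀ (Real.exp_nonneg _)
          rw [Real.exp_neg, one_div]
          apply inv_anti₀ (by norm_num)
          have := Real.add_one_le_exp (1:ℝ)
          linarith
  have h2 : (1 - p/2) ^ D.card ≤ Real.exp (- (p * D.card / 2)) := by
    calc (1 - p/2) ^ D.card ≤ (Real.exp (-(p/2))) ^ D.card := by
          apply pow_le_pow_left₀ (by linarith)
          have := Real.add_one_le_exp (-(p/2))
          linarith
      _ = _ := by rw [← Real.exp_nat_mul]; ring_nf
  have h3 := measureReal_mono (μ := gnp n p) hsub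
  calc _ ≤ _ := h3
    _ = Real.exp t * (Real.exp (-t) * (gnp n p).real {ω | Real.exp (-t) ≤ ∏ e, g e (ω e)}) := by
        rw [← mul_assoc, ← Real.exp_add]; simp
    _ ≤ Real.exp t * Real.exp (- (p * D.card / 2)) := by
        apply mul_le_mul_of_nonneg_left (hmk.trans h2) (Real.exp_nonneg _)
    _ = _ := by rw [← Real.exp_add]; ring_nf

/-- Good packings. -/
def Packing {ι α : Type*} (E : ι → Finset α) (S : Finset ι) : Prop :=
  (S : Set ι).PairwiseDisjoint E

lemma packing_or {ι α : Type*} [Fintype ι] [DecidableEq α] (E : ι → Finset α) (d : ℕ)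
    (hd : 0 < d) (hE : ∀ i, (E i).card = d) (A : Finset α) (k : ℕ) :
    (∃ S : Finset ι, S.card = k ∧ Packing E S ∧ ∀ i ∈ S, E i ⊆ A) ∨
    (∃ R : Finset α, (∃ k' < k, R.card ≤ d * k') ∧ ∀ i, ¬ E i ⊆ A \ R) := by
  classical
  let P : Finset (Finset ι) := Finset.univ.filter fun S => Packing E S ∧ ∀ i ∈ S, E i ⊆ A
  have hP : P.Nonempty := ⟨∅, by
    rw [Finset.mem_filter]
    exact ⟨Finset.mem_univ _, by simp [Packing], by simp⟩⟩
  obtain ⟨S, hS, hmax⟩ := P.exists_max_image Finset.card hP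
  simp only [P, Finset.mem_filter, Finset.mem_univ, true_and] at hS hmax
  by_cases hk : k ≤ S.card
  · left
    obtain ⟨T, hTS, hT⟩ := Finset.exists_subset_card_eq hk
    exact ⟨T, hT, hS.1.subset (by exact_mod_cast hTS), fun i hi => hS.2 i (hTS hi)⟩
  · right
    refine ⟨S.biUnion E, ?_, ?_⟩
    · refine ⟨S.card, by omega, ?_⟩
      rw [mul_comm]
      exact Finset.card_biUnion_le_card_mul _ _ _ (fun i _ => (hE i).le)
    · intro i hi
      have hne : (E i).Nonempty := by rw [← Finset.card_pos, hE]; exact hd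
      have hiS : i ∉ S := by
        intro h
        obtain ⟨x, hx⟩ := hne
        have := hi hx
        simp only [Finset.mem_sdiff, Finset.mem_biUnion, not_exists, not_and] at this
        exact this.2 i h hx
      have := hmax (insert i S) ⟨?_, ?_⟩
      · rw [Finset.card_insert_of_notMem hiS] at this; omega
      · unfold Packing
        rw [Finset.coe_insert]
        refine hS.1.insert fun j hj _ => ?_
        rw [Finset.disjoint_left]
        intro x hx hxj
        have := hi hx
        simp only [Finset.mem_sdiff, Finset.mem_biUnion, not_exists, not_and] at this
        exact this.2 j hj hxj
      · intro j hj
        rcases Finset.mem_insert.1 hj with rfl | hj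
        · exact hi.trans Finset.sdiff_subset
        · exact hS.2 j hj

lemma gnp_packing {n : ℕ} {p : ℝ} (h0 : 0 ≤ p) (h1 : p ≤ 1) {ι : Type*} [Fintype ι]
    (E : ι → Finset (Sym2 (Fin n))) (d : ℕ) (hE : ∀ i, (E i).card = d) (k : ℕ) :
    (gnp n p).real {ω | ∃ S : Finset ι, S.card = k ∧ Packing E S ∧
      ∀ i ∈ S, ∀ e ∈ E i, ω e = true} ≤ (Fintype.card ι * p ^ d) ^ k / k.factorial := by
  classical
  let Q : Finset (Finset ι) := (Finset.univ.powersetCard k).filter fun S => Packing E S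
  have hsub : {ω : Sym2 (Fin n) → Bool | ∃ S : Finset ι, S.card = k ∧ Packing E S ∧
      ∀ i ∈ S, ∀ e ∈ E i, ω e = true} ⊆ ⋃ S ∈ Q, {ω | ∀ e ∈ S.biUnion E, ω e = true} := by
    rintro ω ⟨S, hk, hp, h⟩
    simp only [Set.mem_iUnion]
    refine ⟨S, by simp [Q, hk, hp], ?_⟩
    simp only [Finset.mem_biUnion, Set.mem_ofPred_eq]
    rintro e ⟨i, hi, he⟩
    exact h i hi e he
  have hQ : (Q.card : ℝ) ≤ (Fintype.card ι : ℝ) ^ k / k.factorial := by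
    have : Q.card ≤ (Fintype.card ι).choose k := by
      refine (Finset.card_filter_le _ _).trans ?_
      simp [Finset.card_powersetCard]
    calc (Q.card : ℝ) ≤ ((Fintype.card ι).choose k : ℝ) := by exact_mod_cast this
      _ ≤ _ := Nat.choose_le_pow_div _ _
  calc _ ≤ _ := measureReal_mono hsub (measure_ne_top _ _)
    _ ≤ ∑ S ∈ Q, (gnp n p).real {ω | ∀ e ∈ S.biUnion E, ω e = true} :=
        measureReal_biUnion_finset_le _ _
    _ = ∑ S ∈ Q, p ^ (d * k) := by
        refine Finset.sum_congr rfl fun S hS => ?_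
        rw [gnp_open h0 h1]
        simp only [Q, Finset.mem_filter, Finset.mem_powersetCard] at hS
        rw [Finset.card_biUnion hS.2]
        simp [hE, hS.1.2, mul_comm]
    _ = Q.card * p ^ (d * k) := by simp
    _ ≤ (Fintype.card ι : ℝ) ^ k / k.factorial * p ^ (d * k) := by gcongr
    _ = _ := by rw [mul_pow, ← pow_mul]; ring

lemma gnp_cherry {n : ℕ} {p : ℝ} (h0 : 0 ≤ p) (h1 : p ≤ 1) :
    (gnp n p).real {ω | ∃ x y z : Fin n, y ≠ z ∧ (graphOf ω).Adj x y ∧ (graphOf ω).Adj x z} ≤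
      (n : ℝ) ^ 3 * p ^ 2 := by
  classical
  let Q : Finset (Fin n × Fin n × Fin n) := Finset.univ.filter fun t => t.2.1 ≠ t.2.2
  have hsub : {ω : Sym2 (Fin n) → Bool | ∃ x y z : Fin n, y ≠ z ∧ (graphOf ω).Adj x y ∧
      (graphOf ω).Adj x z} ⊆
      ⋃ t ∈ Q, {ω | ∀ e ∈ ({s(t.1, t.2.1), s(t.1, t.2.2)} : Finset _), ω e = true} := by
    rintro ω ⟨x, y, z, hyz, hxy, hxz⟩
    simp only [Set.mem_iUnion]
    refine ⟨(x, y, z), by simp [Q, hyz], ?_⟩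
    simp only [graphOf, SimpleGraph.fromRel_adj, Sym2.eq_swap (a := y), Sym2.eq_swap (a := z),
      or_self] at hxy hxz
    simp [hxy.2, hxz.2]
  calc _ ≤ _ := measureReal_mono hsub (measure_ne_top _ _)
    _ ≤ ∑ t ∈ Q, (gnp n p).real
        {ω | ∀ e ∈ ({s(t.1, t.2.1), s(t.1, t.2.2)} : Finset _), ω e = true} :=
        measureReal_biUnion_finset_le _ _
    _ = ∑ t ∈ Q, p ^ 2 := by
        refine Finset.sum_congr rfl fun t ht => ?_
        rw [gnp_open h0 h1, Finset.card_pair]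
        simp only [Q, Finset.mem_filter] at ht
        intro h
        apply ht.2
        have h' : t.2.1 = t.2.2 ∨ t.1 = t.2.2 ∧ t.2.1 = t.1 := by simpa using h
        rcases h' with h' | h'
        · exact h'
        · exact h'.2.trans h'.1
    _ = Q.card * p ^ 2 := by simp
    _ ≤ (n : ℝ) ^ 3 * p ^ 2 := by
        gcongr
        have : Q.card ≤ n ^ 3 := by
          refine (Finset.card_filter_le _ _).trans ?_
          simp only [Finset.card_univ, Fintype.card_prod, Fintype.card_fin]
          exact le_of_eq (by ring)
        exact_mod_cast this

lemma cherry_of_maxDeg {V : Type*} [Fintype V] (H : SimpleGraph V) (hΔ : 2 ≤ maxDeg H) :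
    ∃ x y z : V, y ≠ z ∧ H.Adj x y ∧ H.Adj x z := by
  have : ∃ v ∈ Finset.univ, 1 < (H.neighborSet v).ncard := by
    rw [← Finset.lt_sup_iff]; exact hΔ
  obtain ⟨v, -, hv⟩ := this
  obtain ⟨y, z, hy, hz, hyz⟩ := (Set.one_lt_ncard_iff (Set.toFinite _)).1 hv
  exact ⟨v, y, z, hyz, hy, hz⟩

lemma m2_attained {V : Type*} [Fintype V] (H : SimpleGraph V) (hΔ : 2 ≤ maxDeg H) :
    ∃ H' : H.Subgraph, 2 < H'.verts.ncard ∧ 2 ≤ H'.edgeSet.ncard ∧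
      m2 H = ((H'.edgeSet.ncard : ℝ) - 1) / ((H'.verts.ncard : ℝ) - 2) := by
  classical
  obtain ⟨x, y, z, hyz, hxy, hxz⟩ := cherry_of_maxDeg H hΔ
  let X : Set ℝ := {x : ℝ | ∃ H' : H.Subgraph, 0 < H'.edgeSet.ncard ∧
    x = if 2 < H'.verts.ncard
      then ((H'.edgeSet.ncard : ℝ) - 1) / ((H'.verts.ncard : ℝ) - 2)
      else 1 / 2}
  have hX : X.Finite := by
    refine (Set.finite_range fun H' : H.Subgraph => if 2 < H'.verts.ncard
      then ((H'.edgeSet.ncard : ℝ) - 1) / ((H'.verts.ncard : ℝ) - 2)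
      else 1 / 2).subset ?_
    rintro r ⟨H', -, h⟩
    exact ⟨H', h.symm⟩
  let K : H.Subgraph := (⊤ : H.Subgraph).induce {x, y, z}
  have hKv : K.verts.ncard = 3 := by
    have : K.verts = {x, y, z} := rfl
    rw [this, Set.ncard_eq_three]
    exact ⟨x, y, z, hxy.ne, hxz.ne, hyz, rfl⟩
  have hKe : 2 ≤ K.edgeSet.ncard := by
    have hs : ({s(x, y), s(x, z)} : Set (Sym2 V)) ⊆ K.edgeSet := by
      rintro e (rfl | rfl)
      · simp [K, hxy]
      · simp [K, hxz]
    calc 2 = ({s(x, y), s(x, z)} : Set (Sym2 V)).ncard := by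
          rw [Set.ncard_pair]; 
          intro h
          have h' : y = z ∨ x = z ∧ y = x := by simpa using h
          rcases h' with h' | h'
          · exact hyz h'
          · exact hyz (h'.2.trans h'.1)
      _ ≤ _ := Set.ncard_le_ncard hs (Set.toFinite _)
  have hKX : ((K.edgeSet.ncard : ℝ) - 1) / ((K.verts.ncard : ℝ) - 2) ∈ X :=
    ⟨K, by omega, by simp [hKv]⟩
  have h1 : 1 ≤ m2 H := by
    refine le_trans ?_ (le_csSup hX.bddAbove hKX)
    rw [hKv]
    have : (2:ℝ) ≤ K.edgeSet.ncard := by exact_mod_cast hKe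
    norm_num; linarith
  obtain ⟨H', he, hH'⟩ : m2 H ∈ X := Set.Nonempty.csSup_mem ⟨_, hKX⟩ hX
  by_cases hv : 2 < H'.verts.ncard
  · rw [if_pos hv] at hH'
    refine ⟨H', hv, ?_, hH'⟩
    by_contra hlt
    have : H'.edgeSet.ncard = 1 := by omega
    rw [this] at hH'
    norm_num at hH'
    linarith
  · rw [if_neg hv] at hH'
    linarith

lemma edgeSet_graphOf {n : ℕ} (ω : Sym2 (Fin n) → Bool) [DecidablePred (Sym2.IsDiag (α := Fin n))] :
    (graphOf ω).edgeSet =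
      (((Finset.univ.filter fun e : Sym2 (Fin n) => ¬ e.IsDiag).filter fun e => ω e = true :
        Finset (Sym2 (Fin n))) : Set (Sym2 (Fin n))) := by
  ext e
  induction e with
  | h x y =>
    simp [graphOf, SimpleGraph.fromRel_adj, Sym2.eq_swap (a := y) (b := x)]

lemma core {V : Type*} [Fintype V] (H : SimpleGraph V) (H' : H.Subgraph)
    (hd : 0 < H'.edgeSet.ncard) (a : ℝ) (ha1 : a < 1) (n : ℕ) (hn : 2 ≤ n)
    (p : ℝ) (h0 : 0 ≤ p) (h1 : p ≤ 1) (b : ℝ) (hb : 0 < b) (hb16 : b ≤ 1 / 16)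
    (hbd : H'.edgeSet.ncard * b = (1 - a) / 16)
    (hkey : (n:ℝ) ^ H'.verts.ncard * p ^ H'.edgeSet.ncard ≤
      (b * Real.exp (-2)) * ((n:ℝ)^2 * p)) :
    (gnp n p).real {ω | ∃ G : SimpleGraph (Fin n), G ≤ graphOf ω ∧ ¬ ContainsCopy H G ∧
          a * ((graphOf ω).edgeSet.ncard : ℝ) ≤ (G.edgeSet.ncard : ℝ)}ᶜ ≤
      2 * Real.exp (-(b * ((n:ℝ)^2 * p))) := by
  classical
  set d := H'.edgeSet.ncard with hdd
  set l : ℝ := (n:ℝ)^2 * p with hl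
  have hl0 : 0 ≤ l := by positivity
  let E : (H'.verts ↪ Fin n) → Finset (Sym2 (Fin n)) := fun i =>
    (Set.toFinite (Sym2.map i '' H'.coe.edgeSet)).toFinset
  have hE : ∀ i, (E i).card = d := by
    intro i
    rw [← Set.ncard_eq_toFinset_card, Set.ncard_image_of_injective _ (Sym2.map.injective i.injective),
      hdd, ← SimpleGraph.Subgraph.image_coe_edgeSet_coe,
      Set.ncard_image_of_injective _ (Sym2.map.injective Subtype.val_injective)]
  let D : Finset (Sym2 (Fin n)) := Finset.univ.filter fun e => ¬ e.IsDiag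
  have hDc : D.card = n.choose 2 := by
    have := Sym2.card_subtype_not_diag (α := Fin n)
    rw [Fintype.card_subtype, Fintype.card_fin] at this
    exact this
  have hDl : l / 4 ≤ p * D.card := by
    rw [hDc, Nat.cast_choose_two, hl]
    have : (2:ℝ) ≤ n := by exact_mod_cast hn
    have h2 : (n:ℝ)^2/4 ≤ n * (n - 1) / 2 := by nlinarith
    nlinarith
  let k := ⌈b * l⌉₊
  have hk : b * l ≤ k := Nat.le_ceil _
  have hsub : {ω | ∃ G : SimpleGraph (Fin n), G ≤ graphOf ω ∧ ¬ ContainsCopy H G ∧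
          a * ((graphOf ω).edgeSet.ncard : ℝ) ≤ (G.edgeSet.ncard : ℝ)}ᶜ ⊆
      {ω | ((D.filter fun e => ω e = true).card : ℝ) ≤ l / 16} ∪
      {ω | ∃ S : Finset (H'.verts ↪ Fin n), S.card = k ∧ Packing E S ∧
        ∀ i ∈ S, ∀ e ∈ E i, ω e = true} := by
    intro ω hω
    by_contra hno
    rw [Set.mem_union, not_or] at hno
    obtain ⟨hno1, hno2⟩ := hno
    have hcount : l / 16 < ((D.filter fun e => ω e = true).card : ℝ) := not_le.1 hno1
    apply hω
    set A := D.filter fun e => ω e = true with hA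
    have hedge : (graphOf ω).edgeSet = (A : Set (Sym2 (Fin n))) := edgeSet_graphOf ω
    rcases packing_or E d hd hE A k with ⟨S, hS1, hS2, hS3⟩ | ⟨R, ⟨k', hk', hR⟩, hfree⟩
    · exact absurd ⟨S, hS1, hS2, fun i hi e he => (Finset.mem_filter.1 (hS3 i hi he)).2⟩ hno2
    · have hG : ((graphOf ω).deleteEdges (R : Set (Sym2 (Fin n)))).edgeSet =
          ((A \ R : Finset _) : Set (Sym2 (Fin n))) := by
        rw [SimpleGraph.edgeSet_deleteEdges, hedge, Finset.coe_sdiff]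
      refine ⟨(graphOf ω).deleteEdges (R : Set (Sym2 (Fin n))),
        SimpleGraph.deleteEdges_le _, ?_, ?_⟩
      · rintro ⟨f, hf, hadj⟩
        apply hfree ⟨fun x => f x, fun x y hxy => Subtype.val_injective (hf hxy)⟩
        intro e he
        rw [Set.Finite.mem_toFinset] at he
        obtain ⟨e', he', rfl⟩ := he
        rw [← Finset.mem_coe, ← hG]
        induction e' with
        | h x y =>
          have hxy : H'.Adj x y := he'
          exact hadj hxy.adj_sub
      · rw [hG, hedge, Set.ncard_coe_finset, Set.ncard_coe_finset]
        have h2 : A.card ≤ (A \ R).card + R.card := by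
          have := Finset.le_card_sdiff R A
          omega
        have h2' : (A.card : ℝ) ≤ (A \ R).card + R.card := by exact_mod_cast h2
        have h3 : (k' : ℝ) < b * l := Nat.lt_ceil.1 hk'
        have h4 : (R.card : ℝ) ≤ d * k' := by exact_mod_cast hR
        have h5 : (d : ℝ) * k' ≤ d * (b * l) := by gcongr
        have h6 : (d : ℝ) * (b * l) = (1 - a) * (l / 16) := by
          rw [← mul_assoc, hbd]; ring
        have h7 : (1 - a) * (l / 16) ≤ (1 - a) * A.card :=
          mul_le_mul_of_nonneg_left hcount.le (by linarith)
        linarith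
  have hp1 : (gnp n p).real {ω | ((D.filter fun e => ω e = true).card : ℝ) ≤ l / 16} ≤
      Real.exp (-(b * l)) := by
    refine (gnp_chernoff h0 h1 D (l / 16)).trans (Real.exp_le_exp.2 ?_)
    nlinarith
  have hp2 : (gnp n p).real {ω | ∃ S : Finset (H'.verts ↪ Fin n), S.card = k ∧ Packing E S ∧
        ∀ i ∈ S, ∀ e ∈ E i, ω e = true} ≤ Real.exp (-(b * l)) := by
    refine (gnp_packing h0 h1 E d hE k).trans ?_
    have hcard : (Fintype.card (H'.verts ↪ Fin n) : ℝ) ≤ (n:ℝ) ^ H'.verts.ncard := by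
      rw [Fintype.card_embedding_eq, Fintype.card_fin, ← Nat.card_eq_fintype_card,
        Nat.card_coe_set_eq]
      exact_mod_cast Nat.descFactorial_le_pow _ _
    have hmu : (Fintype.card (H'.verts ↪ Fin n) : ℝ) * p ^ d ≤ k * Real.exp (-2) := by
      calc _ ≤ (n:ℝ) ^ H'.verts.ncard * p ^ d := by gcongr
        _ ≤ _ := hkey
        _ = (b * l) * Real.exp (-2) := by ring
        _ ≤ _ := by gcongr
    calc _ ≤ (k * Real.exp (-2)) ^ k / k.factorial := by gcongr
      _ = Real.exp (-2) ^ k * ((k:ℝ) ^ k / k.factorial) := by rw [mul_pow]; ring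
      _ ≤ Real.exp (-2) ^ k * Real.exp k := by
          gcongr
          exact Real.pow_div_factorial_le_exp _ (Nat.cast_nonneg _) _
      _ = Real.exp (-k) := by
          rw [← Real.exp_nat_mul, ← Real.exp_add]; ring_nf
      _ ≤ _ := Real.exp_le_exp.2 (by linarith)
  calc _ ≤ _ := measureReal_mono hsub (measure_ne_top _ _)
    _ ≤ _ := measureReal_union_le _ _
    _ ≤ _ := by linarith

/-- Below the 2-density threshold, a.a.s. `G(n,p)` has an `H`-free spanning subgraph keeping
any given constant fraction `a` of the edges. -/
theorem stmt_2 {V : Type} [Fintype V] (H : SimpleGraph V) (hΔ : 2 ≤ maxDeg H)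
    (a : ℝ) (ha0 : 0 < a) (ha1 : a < 1) :
    ∃ c : ℝ, 0 < c ∧ ∀ p : ℕ → ℝ, (∀ n, 0 ≤ p n ∧ p n ≤ 1) →
      (∀ n : ℕ, p n ≤ c * (n : ℝ) ^ (-(1 / m2 H))) →
      Tendsto (fun n : ℕ => gnp n (p n)
        {ω | ∃ G : SimpleGraph (Fin n), G ≤ graphOf ω ∧ ¬ ContainsCopy H G ∧
          a * ((graphOf ω).edgeSet.ncard : ℝ) ≤ (G.edgeSet.ncard : ℝ)})
        atTop (𝓝 1) := by
  classical
  obtain ⟨H', hv, he, hm⟩ := m2_attained H hΔ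
  set d := H'.edgeSet.ncard with hd
  set v := H'.verts.ncard with hv'
  have hdR : (2:ℝ) ≤ d := by exact_mod_cast he
  have hvR : (2:ℝ) < v := by exact_mod_cast hv
  set b : ℝ := (1 - a) / (16 * d) with hb
  have hbpos : 0 < b := div_pos (by linarith) (by linarith)
  have hb16 : b ≤ 1 / 16 := by
    rw [hb, div_le_div_iff₀ (by linarith) (by norm_num)]
    nlinarith
  have hbd : d * b = (1 - a) / 16 := by rw [hb]; field_simp
  set c : ℝ := b * Real.exp (-2) with hc
  have hcpos : 0 < c := mul_pos hbpos (Real.exp_pos _)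
  have hc1 : c ≤ 1 := by
    have : Real.exp (-2) ≤ 1 := Real.exp_le_one_iff.2 (by norm_num)
    nlinarith [Real.exp_pos (-2)]
  refine ⟨c, hcpos, fun p hp hpc => ?_⟩
  let bound : ℕ → ℝ := fun n => (n : ℝ) ^ (-(1/2) : ℝ) + 2 * Real.exp (-(b * (n : ℝ) ^ (1/4 : ℝ)))
  have hbound : Tendsto bound atTop (𝓝 0) := by
    have t1 : Tendsto (fun n : ℕ => (n : ℝ) ^ (-(1/2) : ℝ)) atTop (𝓝 0) :=
      (tendsto_rpow_neg_atTop (by norm_num : (0:ℝ) < 1/2)).comp tendsto_natCast_atTop_atTop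
    have t2 : Tendsto (fun n : ℕ => b * (n : ℝ) ^ (1/4 : ℝ)) atTop atTop :=
      ((tendsto_rpow_atTop (by norm_num : (0:ℝ) < 1/4)).comp
        tendsto_natCast_atTop_atTop).const_mul_atTop hbpos
    have t3 := (Real.tendsto_exp_neg_atTop_nhds_zero.comp t2).const_mul 2
    simpa [bound] using t1.add t3
  refine tendsto_of_tendsto_of_tendsto_of_le_of_le'
    (g := fun n => ENNReal.ofReal (1 - bound n)) (h := fun _ => 1) ?_ tendsto_const_nhds ?_ ?_
  · have := ENNReal.tendsto_ofReal (hbound.const_sub 1)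
    simpa using this
  · filter_upwards [eventually_ge_atTop 2] with n hn
    rw [← ofReal_measureReal]
    apply ENNReal.ofReal_le_ofReal
    have hcompl := probReal_compl_eq_one_sub (μ := gnp n (p n)) (MeasurableSet.of_discrete
      (s := {ω | ∃ G : SimpleGraph (Fin n), G ≤ graphOf ω ∧ ¬ ContainsCopy H G ∧
          a * ((graphOf ω).edgeSet.ncard : ℝ) ≤ (G.edgeSet.ncard : ℝ)}))
    suffices h : (gnp n (p n)).real {ω | ∃ G : SimpleGraph (Fin n), G ≤ graphOf ω ∧
        ¬ ContainsCopy H G ∧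
          a * ((graphOf ω).edgeSet.ncard : ℝ) ≤ (G.edgeSet.ncard : ℝ)}ᶜ ≤ bound n by linarith
    obtain ⟨hp0, hp1⟩ := hp n
    have hn0 : (0:ℝ) < n := by
      have : 0 < n := by omega
      exact_mod_cast this
    by_cases hl : (n:ℝ)^2 * p n ≤ (n : ℝ) ^ (1/4 : ℝ)
    · have hsub : {ω | ∃ G : SimpleGraph (Fin n), G ≤ graphOf ω ∧ ¬ ContainsCopy H G ∧
          a * ((graphOf ω).edgeSet.ncard : ℝ) ≤ (G.edgeSet.ncard : ℝ)}ᶜ ⊆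
          {ω | ∃ x y z : Fin n, y ≠ z ∧ (graphOf ω).Adj x y ∧ (graphOf ω).Adj x z} := by
        intro ω hω
        by_contra hno
        apply hω
        refine ⟨graphOf ω, le_rfl, ?_, ?_⟩
        · rintro ⟨f, hf, hadj⟩
          obtain ⟨x, y, z, hyz, hxy, hxz⟩ := cherry_of_maxDeg H hΔ
          exact hno ⟨f x, f y, f z, hf.ne hyz, hadj hxy, hadj hxz⟩
        · have : (0:ℝ) ≤ (graphOf ω).edgeSet.ncard := Nat.cast_nonneg _
          nlinarith
      have h1 := (measureReal_mono hsub (measure_ne_top _ _)).trans (gnp_cherry hp0 hp1)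
      refine h1.trans ?_
      have h2 : (n:ℝ)^3 * p n ^ 2 ≤ (n : ℝ) ^ (-(1/2) : ℝ) := by
        have e1 : ((n : ℝ) ^ (1/4 : ℝ)) ^ 2 = n * (n : ℝ) ^ (-(1/2) : ℝ) := by
          rw [← Real.rpow_natCast, ← Real.rpow_mul hn0.le]
          nth_rewrite 2 [← Real.rpow_one (n:ℝ)]
          rw [← Real.rpow_add hn0]
          norm_num
        have e2 : ((n:ℝ)^2 * p n)^2 ≤ ((n : ℝ) ^ (1/4 : ℝ)) ^ 2 :=
          pow_le_pow_left₀ (by positivity) hl 2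
        rw [e1] at e2
        have e3 : (n:ℝ) * ((n:ℝ)^3 * p n ^ 2) ≤ n * (n : ℝ) ^ (-(1/2) : ℝ) := by
          calc _ = ((n:ℝ)^2 * p n)^2 := by ring
            _ ≤ _ := e2
        exact le_of_mul_le_mul_left e3 hn0
      have := Real.exp_pos (-(b * (n : ℝ) ^ (1/4 : ℝ)))
      simp only [bound]
      linarith
    · push Not at hl
      have hkey : (n:ℝ)^v * p n ^ d ≤ c * ((n:ℝ)^2 * p n) := by
        have hd1 : d = (d - 1) + 1 := by omega
        have hv1 : v = (v - 2) + 2 := by omega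
        have hcast1 : ((d - 1 : ℕ) : ℝ) = d - 1 := by
          rw [Nat.cast_sub (by omega)]; norm_num
        have hcast2 : ((v - 2 : ℕ) : ℝ) = v - 2 := by
          rw [Nat.cast_sub (by omega)]; norm_num
        have hpow : p n ^ (d - 1) ≤ c * ((n:ℝ) ^ (v - 2))⁻¹ := by
          calc p n ^ (d - 1) ≤ (c * (n : ℝ) ^ (-(1 / m2 H))) ^ (d - 1) :=
                pow_le_pow_left₀ hp0 (hpc n) _
            _ = c ^ (d - 1) * ((n:ℝ) ^ (v - 2))⁻¹ := by
                rw [mul_pow]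
                congr 1
                rw [← Real.rpow_natCast, ← Real.rpow_mul hn0.le, ← Real.rpow_natCast,
                  ← Real.rpow_neg hn0.le, hcast1, hcast2, hm]
                congr 1
                have h1 : (d:ℝ) - 1 ≠ 0 := by linarith
                have h2 : (v:ℝ) - 2 ≠ 0 := by linarith
                field_simp
            _ ≤ c * ((n:ℝ) ^ (v - 2))⁻¹ := by
                gcongr
                exact pow_le_of_le_one hcpos.le hc1 (by omega)
        calc (n:ℝ)^v * p n ^ d = (n:ℝ)^2 * p n * ((n:ℝ)^(v-2) * p n ^ (d-1)) := by
              conv_lhs => rw [hd1, hv1]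
              rw [pow_succ, pow_add]; ring
          _ ≤ (n:ℝ)^2 * p n * ((n:ℝ)^(v-2) * (c * ((n:ℝ) ^ (v - 2))⁻¹)) := by gcongr
          _ = _ := by field_simp
      have := core H H' (by omega) a ha1 n hn (p n) hp0 hp1 b hbpos hb16 hbd hkey
      refine this.trans ?_
      simp only [bound]
      have h1 : Real.exp (-(b * ((n:ℝ)^2 * p n))) ≤ Real.exp (-(b * (n : ℝ) ^ (1/4 : ℝ))) := by
        apply Real.exp_le_exp.2
        have := mul_le_mul_of_nonneg_left hl.le hbpos.le
        linarith
      have h2 : 0 ≤ (n : ℝ) ^ (-(1/2) : ℝ) := by positivity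
      linarith
  · exact Filter.Eventually.of_forall fun n => prob_le_one
end

section
/- Let (H_n) be a sequence of graphs where H_n has n vertices and maximum degree Δ = Δ(H_n) satisfying Δ² ≤ √n − 1. If p = p(n) ≥ (20·Δ²·log n / n)^{1/Δ}, then a.a.s. G(n,p) contains a copy of H_n. -/
open MeasureTheory Filter Topology

section AF
open ProbabilityTheory

variable {ι : Type*} [Fintype ι]

lemma af_inter (ν : Measure Bool) [IsProbabilityMeasure ν] (S T : Finset ι)
    (hST : Disjoint S T) (A B : Set (ι → Bool))
    (hA : ∀ ω ω' : ι → Bool, (∀ i ∈ S, ω i = ω' i) → ω ∈ A → ω' ∈ A)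
    (hB : ∀ ω ω' : ι → Bool, (∀ i ∈ T, ω i = ω' i) → ω ∈ B → ω' ∈ B) :
    (Measure.pi fun _ : ι => ν).real (A ∩ B) =
      (Measure.pi fun _ : ι => ν).real A * (Measure.pi fun _ : ι => ν).real B := by
  classical
  have h0 : iIndepFun (fun (i : ι) (ω : ι → Bool) => ω i) (Measure.pi fun _ : ι => ν) :=
    iIndepFun_pi (μ := fun _ : ι => ν) (X := fun _ => id) (fun i => aemeasurable_id)
  have h1 := h0.indepFun_finset S T hST (fun i => measurable_pi_apply i)
  have hA' : A = (fun (ω : ι → Bool) (i : S) => ω i) ⁻¹'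
      ((fun (ω : ι → Bool) (i : S) => ω i) '' A) := by
    apply Set.Subset.antisymm (Set.subset_preimage_image _ _)
    rintro ω ⟨ω', h, he⟩
    exact hA ω' ω (fun i hi => congrFun he ⟨i, hi⟩) h
  have hB' : B = (fun (ω : ι → Bool) (i : T) => ω i) ⁻¹'
      ((fun (ω : ι → Bool) (i : T) => ω i) '' B) := by
    apply Set.Subset.antisymm (Set.subset_preimage_image _ _)
    rintro ω ⟨ω', h, he⟩
    exact hB ω' ω (fun i hi => congrFun he ⟨i, hi⟩) h
  have := h1.measure_inter_preimage_eq_mul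
    ((fun (ω : ι → Bool) (i : S) => ω i) '' A) ((fun (ω : ι → Bool) (i : T) => ω i) '' B)
    (Set.toFinite _).measurableSet (Set.toFinite _).measurableSet
  rw [← hA', ← hB'] at this
  simp only [measureReal_def, this, ENNReal.toReal_mul]

lemma af_decouple (ν : Measure Bool) [IsProbabilityMeasure ν] (S T : Finset ι)
    (hST : Disjoint S T) {F : Type*} [Fintype F] (X : (ι → Bool) → F) (B : F → Set (ι → Bool))
    (ε : ℝ) 
    (hX : ∀ ω ω' : ι → Bool, (∀ i ∈ S, ω i = ω' i) → X ω = X ω')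
    (hB : ∀ f, ∀ ω ω' : ι → Bool, (∀ i ∈ T, ω i = ω' i) → ω ∈ B f → ω' ∈ B f)
    (hε : ∀ ω, (Measure.pi fun _ : ι => ν).real (B (X ω)) ≤ ε) :
    (Measure.pi fun _ : ι => ν).real {ω | ω ∈ B (X ω)} ≤ ε := by
  classical
  set μ := Measure.pi fun _ : ι => ν with hμ
  have h1 : {ω | ω ∈ B (X ω)} = ⋃ f ∈ (Finset.univ : Finset F), (X ⁻¹' {f} ∩ B f) := by
    ext ω; simp
  have hms : ∀ s : Set (ι → Bool), MeasurableSet s := fun s => (Set.toFinite s).measurableSet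
  rw [h1]
  have h2 : ∀ f, μ.real (X ⁻¹' {f} ∩ B f) ≤ μ.real (X ⁻¹' {f}) * ε := by
    intro f
    rw [hμ, af_inter ν S T hST _ _ _ (hB f)]
    · by_cases h : (X ⁻¹' {f}).Nonempty
      · obtain ⟨ω, hω⟩ := h
        have := hε ω
        rw [show X ω = f from hω] at this
        gcongr
      · rw [Set.not_nonempty_iff_eq_empty] at h
        simp [h]
    · intro ω ω' h hω
      simp only [Set.mem_preimage, Set.mem_singleton_iff] at *
      rw [← hX ω ω' h, hω]
  have h3 : ∑ f, μ.real (X ⁻¹' {f}) = 1 := by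
    rw [← measureReal_biUnion_finset]
    · have : (⋃ f ∈ (Finset.univ : Finset F), X ⁻¹' {f}) = Set.univ := by ext; simp
      rw [this]; simp [μ]
    · intro a _ b _ hab
      exact Set.disjoint_left.2 fun ω h1 h2 => hab (h1.symm.trans h2)
    · intro b _; exact hms _
  calc _ ≤ ∑ f, μ.real (X ⁻¹' {f} ∩ B f) := measureReal_biUnion_finset_le _ _
    _ ≤ ∑ f, μ.real (X ⁻¹' {f}) * ε := Finset.sum_le_sum fun f _ => h2 f
    _ = ε := by rw [← Finset.sum_mul, h3, one_mul]

lemma af_all_true (ν : Measure Bool) [IsProbabilityMeasure ν] (p : ℝ) (hν : ν.real {true} = p)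
    (P : Finset ι) :
    (Measure.pi fun _ : ι => ν).real {ω | ∀ i ∈ P, ω i = true} = p ^ P.card := by
  classical
  induction P using Finset.induction_on with
  | empty => simp
  | insert a P ha ih =>
    have h1 : {ω : ι → Bool | ∀ i ∈ insert a P, ω i = true} =
        {ω | ω a = true} ∩ {ω | ∀ i ∈ P, ω i = true} := by ext; simp
    rw [h1, af_inter ν {a} P (by simpa using ha), ih, Finset.card_insert_of_notMem ha, pow_succ,
      mul_comm]
    · congr 1
      rw [← hν, ← (measurePreserving_eval (fun _ : ι => ν) a).measureReal_preimage]
      · rfl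
      · exact (Set.toFinite _).measurableSet.nullMeasurableSet
    · intro ω ω' h hω
      have := h a (by simp)
      simp only [Set.mem_ofPred_eq] at *
      rw [← this, hω]
    · intro ω ω' h hω i hi
      rw [← h i hi, hω i hi]

lemma af_block (ν : Measure Bool) [IsProbabilityMeasure ν] (p : ℝ) (hν : ν.real {true} = p)
    (hp0 : 0 ≤ p) (hp1 : p ≤ 1) (Δ : ℕ)
    {κ : Type*} (J : Finset κ) (P : κ → Finset ι) (hcard : ∀ j ∈ J, (P j).card ≤ Δ)
    (hdis : ∀ j ∈ J, ∀ k ∈ J, j ≠ k → Disjoint (P j) (P k)) :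
    (Measure.pi fun _ : ι => ν).real {ω | ∀ j ∈ J, ¬ ∀ i ∈ P j, ω i = true} ≤
      (1 - p ^ Δ) ^ J.card := by
  classical
  induction J using Finset.induction_on with
  | empty => simp
  | insert a J ha ih =>
    have h1 : {ω : ι → Bool | ∀ j ∈ insert a J, ¬ ∀ i ∈ P j, ω i = true} =
        {ω | ∀ i ∈ P a, ω i = true}ᶜ ∩ {ω | ∀ j ∈ J, ¬ ∀ i ∈ P j, ω i = true} := by
      ext; simp
    rw [h1, af_inter ν (P a) (J.biUnion P), Finset.card_insert_of_notMem ha, pow_succ, mul_comm]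
    · have h2 : (Measure.pi fun _ : ι => ν).real {ω | ∀ i ∈ P a, ω i = true}ᶜ ≤ 1 - p ^ Δ := by
        rw [probReal_compl_eq_one_sub (Set.toFinite _).measurableSet, af_all_true ν p hν]
        have := pow_le_pow_of_le_one hp0 hp1 (hcard a (by simp))
        linarith
      have h3 : 0 ≤ 1 - p ^ Δ := by
        have := pow_le_one₀ hp0 hp1 (n := Δ); linarith
      have := ih (fun j hj => hcard j (by simp [hj]))
        (fun j hj k hk => hdis j (by simp [hj]) k (by simp [hk]))
      gcongr
    · rw [Finset.disjoint_biUnion_right]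
      intro i hi
      exact hdis a (by simp) i (by simp [hi]) (by rintro rfl; exact ha hi)
    · intro ω ω' h hω h'
      exact hω fun i hi => by rw [h i hi, h' i hi]
    · intro ω ω' h hω j hj h'
      exact hω j hj fun i hi => by
        rw [h i (Finset.mem_biUnion.2 ⟨j, hj, hi⟩), h' i hi]

end AF

section AFcol

variable {V : Type*} [Fintype V] [DecidableEq V]

lemma af_indep (K : SimpleGraph V) [DecidableRel K.Adj] (D : ℕ) (hD : ∀ v, K.degree v ≤ D)
    (s : ℕ) : ∀ R : Finset V, s * (D + 1) ≤ R.card →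
      ∃ I ⊆ R, I.card = s ∧ ∀ v ∈ I, ∀ w ∈ I, ¬ K.Adj v w := by
  induction s with
  | zero => intro R _; exact ⟨∅, by simp, by simp, by simp⟩
  | succ s ih =>
    intro R hR
    have hne : R.Nonempty := by
      rw [← Finset.card_pos]; nlinarith
    obtain ⟨v, hv⟩ := hne
    obtain ⟨I, hIR, hI, hind⟩ := ih (R \ insert v (K.neighborFinset v)) (by
      have h1 := Finset.le_card_sdiff (insert v (K.neighborFinset v)) R
      have h2 := Finset.card_insert_le v (K.neighborFinset v)
      have h3 := hD v
      rw [SimpleGraph.card_neighborFinset_eq_degree] at h2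
      have : (s + 1) * (D + 1) = s * (D + 1) + (D + 1) := by ring
      omega)
    have hnot : ∀ w ∈ I, w ≠ v ∧ ¬ K.Adj v w := by
      intro w hw
      have := hIR hw
      simp at this
      exact this.2
    refine ⟨insert v I, ?_, ?_, ?_⟩
    · intro w hw
      rcases Finset.mem_insert.1 hw with rfl | hw
      · exact hv
      · exact (Finset.mem_sdiff.1 (hIR hw)).1
    · rw [Finset.card_insert_of_notMem (fun h => (hnot v h).1 rfl), hI]
    · intro a ha b hb
      rcases Finset.mem_insert.1 ha with rfl | ha' <;> rcases Finset.mem_insert.1 hb with rfl | hb'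
      · exact K.irrefl
      · exact (hnot b hb').2
      · exact fun h => (hnot a ha').2 h.symm
      · exact hind a ha' b hb'

lemma af_extend (K : SimpleGraph V) [DecidableRel K.Adj] (D : ℕ) (hD : ∀ v, K.degree v ≤ D)
    (W : Finset V) (c : V → ℕ) (hc : ∀ v ∈ W, c v < D + 1)
    (hp : ∀ v ∈ W, ∀ w ∈ W, K.Adj v w → c v ≠ c w) (U : Finset V) :
    ∃ c' : V → ℕ, (∀ v ∈ W, c' v = c v) ∧ (∀ v ∈ W ∪ U, c' v < D + 1) ∧
      ∀ v ∈ W ∪ U, ∀ w ∈ W ∪ U, K.Adj v w → c' v ≠ c' w := by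
  induction U using Finset.induction_on with
  | empty => exact ⟨c, by simp, by simpa using hc, by simpa using hp⟩
  | insert u U hu ih =>
    obtain ⟨c', h1, h2, h3⟩ := ih
    by_cases huW : u ∈ W
    · have : W ∪ insert u U = W ∪ U := by
        ext x; simp only [Finset.mem_union, Finset.mem_insert]
        constructor
        · rintro (h | rfl | h) <;> tauto
        · tauto
      rw [this]; exact ⟨c', h1, h2, h3⟩
    · obtain ⟨k, hk, hk'⟩ : ∃ k ∈ Finset.range (D + 1), k ∉ (K.neighborFinset u).image c' := by
        apply Finset.exists_mem_notMem_of_card_lt_card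
        have := (Finset.card_image_le (s := K.neighborFinset u) (f := c'))
        rw [SimpleGraph.card_neighborFinset_eq_degree] at this
        have := hD u
        simp; omega
      have hk2 : ∀ w, K.Adj u w → c' w ≠ k := by
        intro w hw h
        exact hk' (Finset.mem_image.2 ⟨w, by simpa using hw, h⟩)
      refine ⟨Function.update c' u k, ?_, ?_, ?_⟩
      · intro v hv
        rw [Function.update_of_ne (by rintro rfl; exact huW hv), h1 v hv]
      · intro v hv
        by_cases h : v = u
        · subst h; simpa using hk
        · rw [Function.update_of_ne h]; apply h2
          simp at hv ⊢; tauto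
      · intro v hv w hw hvw
        have hv' : v ≠ u → v ∈ W ∪ U := by simp at hv ⊢; tauto
        have hw' : w ≠ u → w ∈ W ∪ U := by simp at hw ⊢; tauto
        by_cases h : v = u
        · subst h
          rw [Function.update_self, Function.update_of_ne hvw.ne.symm]
          exact (hk2 w hvw).symm
        · by_cases h' : w = u
          · subst h'
            rw [Function.update_self, Function.update_of_ne h]
            exact hk2 v hvw.symm
          · rw [Function.update_of_ne h, Function.update_of_ne h']
            exact h3 v (hv' h) w (hw' h') hvw

lemma af_partial (K : SimpleGraph V) [DecidableRel K.Adj] (D : ℕ) (hD : ∀ v, K.degree v ≤ D)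
    (s : ℕ) (hs : s * (2 * D + 1) ≤ Fintype.card V) (j : ℕ) (hj : j ≤ D + 1) :
    ∃ (W : Finset V) (c : V → ℕ), W.card = j * s ∧ (∀ v ∈ W, c v < j) ∧
      (∀ v ∈ W, ∀ w ∈ W, K.Adj v w → c v ≠ c w) ∧
      ∀ i < j, s ≤ (W.filter (fun v => c v = i)).card := by
  induction j with
  | zero => exact ⟨∅, fun _ => 0, by simp, by simp, by simp, by simp⟩
  | succ j ih =>
    obtain ⟨W, c, hW, hc, hp, hcl⟩ := ih (by omega)
    obtain ⟨I, hIW, hI, hind⟩ := af_indep K D hD s Wᶜ (by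
      rw [Finset.card_compl, hW]
      have : j * s ≤ D * s := Nat.mul_le_mul_right _ (by omega)
      have : s * (2 * D + 1) = s * (D + 1) + D * s := by ring
      omega)
    have hdis : Disjoint W I := by
      rw [Finset.disjoint_left]; intro a ha h
      exact (Finset.mem_compl.1 (hIW h)) ha
    have hWI : ∀ v ∈ W, v ∉ I := fun v hv h => Finset.disjoint_left.1 hdis hv h
    refine ⟨W ∪ I, fun v => if v ∈ I then j else c v, ?_, ?_, ?_, ?_⟩
    · rw [Finset.card_union_of_disjoint hdis, hW, hI]; ring
    · intro v hv
      by_cases h : v ∈ I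
      · simp [h]
      · simp only [h, if_false]
        have := hc v (by simp [h] at hv; exact hv)
        omega
    · intro v hv w hw hvw
      have hv' : v ∉ I → v ∈ W := by simp at hv; tauto
      have hw' : w ∉ I → w ∈ W := by simp at hw; tauto
      by_cases h : v ∈ I <;> by_cases h' : w ∈ I <;> simp only [h, h', if_true, if_false]
      · exact absurd hvw (hind v h w h')
      · exact (hc w (hw' h')).ne'
      · exact (hc v (hv' h)).ne
      · exact hp v (hv' h) w (hw' h') hvw
    · intro i hi
      by_cases hij : i = j
      · subst hij
        rw [← hI]
        apply Finset.card_le_card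
        intro v hv
        simp [hv]
      · refine (hcl i (by omega)).trans (Finset.card_le_card ?_)
        intro v hv
        simp only [Finset.mem_filter, Finset.mem_union] at hv ⊢
        simp [hWI v hv.1, hv]

lemma af_color (K : SimpleGraph V) [DecidableRel K.Adj] (D : ℕ) (hD : ∀ v, K.degree v ≤ D)
    (s : ℕ) (hs : s * (2 * D + 1) ≤ Fintype.card V) :
    ∃ c : V → ℕ, (∀ v, c v < D + 1) ∧ (∀ v w, K.Adj v w → c v ≠ c w) ∧
      ∀ i < D + 1, s ≤ (Finset.univ.filter (fun v => c v = i)).card := by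
  obtain ⟨W, c, hW, hc, hp, hcl⟩ := af_partial K D hD s hs (D + 1) le_rfl
  obtain ⟨c', h1, h2, h3⟩ := af_extend K D hD W c hc hp Finset.univ
  refine ⟨c', fun v => h2 v (by simp), fun v w => h3 v (by simp) w (by simp), fun i hi => ?_⟩
  refine (hcl i hi).trans (Finset.card_le_card ?_)
  intro v hv
  simp only [Finset.mem_filter, Finset.mem_univ, true_and] at hv ⊢
  rw [h1 v hv.1, hv.2]

/-- the square of a graph has maximum degree at most `Δ ^ 2` -/
lemma af_square (H : SimpleGraph V) (Δ : ℕ) (hΔ : ∀ v, (H.neighborSet v).ncard ≤ Δ)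
    (s : ℕ) (hs : s * (2 * Δ ^ 2 + 1) ≤ Fintype.card V) :
    ∃ c : V → ℕ, (∀ v, c v < Δ ^ 2 + 1) ∧ (∀ v w, H.Adj v w → c v ≠ c w) ∧
      (∀ u v w, v ≠ w → H.Adj u v → H.Adj u w → c v ≠ c w) ∧
      ∀ i < Δ ^ 2 + 1, s ≤ (Finset.univ.filter (fun v => c v = i)).card := by
  classical
  have hdeg : ∀ v, (H.neighborFinset v).card ≤ Δ := by
    intro v
    rw [← Set.ncard_coe_finset, SimpleGraph.coe_neighborFinset]; exact hΔ v
  let K : SimpleGraph V :=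
    { Adj := fun v w => v ≠ w ∧ (H.Adj v w ∨ ∃ u, H.Adj u v ∧ H.Adj u w)
      symm := ⟨fun v w h => ⟨h.1.symm, h.2.elim (fun h => Or.inl h.symm)
        fun ⟨u, h1, h2⟩ => Or.inr ⟨u, h2, h1⟩⟩⟩
      loopless := ⟨fun v h => h.1 rfl⟩ }
  have hK : ∀ v, K.degree v ≤ Δ ^ 2 := by
    intro v
    rw [← SimpleGraph.card_neighborFinset_eq_degree]
    have hsub : K.neighborFinset v ⊆ (H.neighborFinset v).biUnion
        (fun u => insert u ((H.neighborFinset u).erase v)) := by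
      intro w hw
      rw [SimpleGraph.mem_neighborFinset] at hw
      obtain ⟨hne, h | ⟨u, h1, h2⟩⟩ := hw
      · exact Finset.mem_biUnion.2 ⟨w, by simpa using h, by simp⟩
      · refine Finset.mem_biUnion.2 ⟨u, by simpa using h1.symm, ?_⟩
        simp [h2, hne.symm]
    refine (Finset.card_le_card hsub).trans ((Finset.card_biUnion_le_card_mul _ _ Δ ?_).trans ?_)
    · intro u hu
      have hvu : v ∈ H.neighborFinset u := by
        simp only [SimpleGraph.mem_neighborFinset] at hu ⊢; exact hu.symm
      refine (Finset.card_insert_le _ _).trans ?_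
      rw [Finset.card_erase_add_one hvu]
      exact hdeg u
    · rw [pow_two]; exact Nat.mul_le_mul_right _ (hdeg v)
  obtain ⟨c, h1, h2, h3⟩ := af_color K (Δ ^ 2) hK s hs
  exact ⟨c, h1, fun v w h => h2 v w ⟨h.ne, Or.inl h⟩,
    fun u v w hne ha hb => h2 v w ⟨hne, Or.inr ⟨u, ha, hb⟩⟩, h3⟩

end AFcol

section AFmatch

lemma af_hall {A : Type*} [Fintype A] [DecidableEq A] (r : A → A → Prop)
    (h : ¬ ∃ g : A → A, Function.Injective g ∧ ∀ a, r a (g a)) :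
    ∃ k ∈ Finset.Icc 1 (Fintype.card A), ∃ S ∈ Finset.powersetCard k (Finset.univ : Finset A),
      ∃ T ∈ Finset.powersetCard (Fintype.card A + 1 - k) (Finset.univ : Finset A),
        ∀ a ∈ S, ∀ b ∈ T, ¬ r a b := by
  classical
  have h1 := mt (Finset.all_card_le_biUnion_card_iff_exists_injective
    (fun a => Finset.univ.filter (fun b => r a b))).1 (by simpa using h)
  push Not at h1
  obtain ⟨S, hS⟩ := h1
  set N := S.biUnion (fun a => Finset.univ.filter (fun b => r a b)) with hN
  have hc := Finset.card_compl N
  have hSle := Finset.card_le_univ S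
  obtain ⟨T, hT, hTc⟩ := Finset.exists_subset_card_eq
    (s := Nᶜ) (n := Fintype.card A + 1 - S.card) (by omega)
  refine ⟨S.card, Finset.mem_Icc.2 ⟨by omega, hSle⟩, S, by simp [Finset.mem_powersetCard], T,
    by simp [Finset.mem_powersetCard, hTc], ?_⟩
  intro a ha b hb hr
  have := hT hb
  rw [Finset.mem_compl] at this
  exact this (Finset.mem_biUnion.2 ⟨a, ha, by simpa using hr⟩)

lemma af_num1 (n m a b : ℕ) (q : ℝ) (hn : 1 ≤ n) (hmn : m ≤ n) (ha : 1 ≤ a) (hab : a ≤ b)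
    (hm : a + b = m + 1) (hq0 : 0 ≤ q) (hq1 : q ≤ 1) (hq : 3 * Real.log n ≤ q * m / 2) :
    (m.choose a : ℝ) * (m.choose b : ℝ) * (1 - q) ^ (a * b) ≤ 1 / (n : ℝ) ^ 2 := by
  obtain ⟨a', rfl⟩ : ∃ a', a = a' + 1 := ⟨a - 1, by omega⟩
  have hn' : (1 : ℝ) ≤ n := by exact_mod_cast hn
  have hn0 : (0 : ℝ) < n := by linarith
  have h1 : (m.choose (a' + 1) : ℝ) ≤ (n : ℝ) ^ (a' + 1) := by
    have : m.choose (a' + 1) ≤ n ^ (a' + 1) :=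
      (Nat.choose_le_pow m _).trans (Nat.pow_le_pow_left hmn _)
    exact_mod_cast this
  have h2 : (m.choose b : ℝ) ≤ (n : ℝ) ^ a' := by
    have : m.choose b ≤ n ^ a' := by
      have hb : b ≤ m := by omega
      rw [← Nat.choose_symm hb, show m - b = a' by omega]
      exact (Nat.choose_le_pow m _).trans (Nat.pow_le_pow_left hmn _)
    exact_mod_cast this
  have h3 : (1 - q) ^ b ≤ 1 / (n : ℝ) ^ 3 := by
    have e1 : 1 - q ≤ Real.exp (-q) := by have := Real.add_one_le_exp (-q); linarith
    have hb2 : (m : ℝ) / 2 ≤ b := by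
      have : m ≤ 2 * b := by omega
      have : (m : ℝ) ≤ 2 * b := by exact_mod_cast this
      linarith
    calc (1 - q) ^ b ≤ Real.exp (-q) ^ b := pow_le_pow_left₀ (by linarith) e1 _
      _ = Real.exp (b * (-q)) := by rw [Real.exp_nat_mul]
      _ ≤ Real.exp (-(3 * Real.log n)) := by
        apply Real.exp_le_exp.2
        nlinarith
      _ = 1 / (n : ℝ) ^ 3 := by
        rw [Real.exp_neg, show (3 : ℝ) * Real.log n = ((3 : ℕ) : ℝ) * Real.log n by norm_num,
          Real.exp_nat_mul, Real.exp_log hn0, one_div]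
  have h4 : (1 - q) ^ ((a' + 1) * b) ≤ (1 / (n : ℝ) ^ 3) ^ (a' + 1) := by
    rw [mul_comm, pow_mul]
    exact pow_le_pow_left₀ (pow_nonneg (by linarith) _) h3 _
  have h5 : 0 ≤ (1 - q) ^ ((a' + 1) * b) := pow_nonneg (by linarith) _
  calc _ ≤ (n : ℝ) ^ (a' + 1) * (n : ℝ) ^ a' * (1 / (n : ℝ) ^ 3) ^ (a' + 1) := by gcongr
    _ = (1 / (n : ℝ) ^ 2) * (1 / (n : ℝ) ^ a') := by
      rw [div_pow, one_pow, ← pow_mul, show 3 * (a' + 1) = (a' + 1) + a' + 2 + a' by ring,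
        pow_add, pow_add, pow_add]
      field_simp
      ring
    _ ≤ (1 / (n : ℝ) ^ 2) * 1 := by
      gcongr
      rw [div_le_one (by positivity)]
      exact one_le_pow₀ hn'
    _ = _ := mul_one _

lemma af_num (n m k : ℕ) (q : ℝ) (hn : 1 ≤ n) (hmn : m ≤ n) (hk : 1 ≤ k) (hkm : k ≤ m)
    (hq0 : 0 ≤ q) (hq1 : q ≤ 1) (hq : 3 * Real.log n ≤ q * m / 2) :
    (m.choose k : ℝ) * (m.choose (m + 1 - k) : ℝ) * (1 - q) ^ (k * (m + 1 - k))
      ≤ 1 / (n : ℝ) ^ 2 := by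
  rcases le_total k (m + 1 - k) with h | h
  · exact af_num1 n m k (m + 1 - k) q hn hmn hk h (by omega) hq0 hq1 hq
  · have := af_num1 n m (m + 1 - k) k q hn hmn (by omega) h (by omega) hq0 hq1 hq
    rw [mul_comm (m.choose k : ℝ), mul_comm k]
    exact this

lemma af_match {ι : Type*} [Fintype ι] (ν : Measure Bool) [IsProbabilityMeasure ν] (p : ℝ)
    (hν : ν.real {true} = p) (hp0 : 0 ≤ p) (hp1 : p ≤ 1) (Δ n : ℕ) (hn : 1 ≤ n)
    {A : Type*} [Fintype A] [DecidableEq A] (hAn : Fintype.card A ≤ n)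
    (hq : 3 * Real.log n ≤ p ^ Δ * (Fintype.card A : ℝ) / 2)
    (P : A × A → Finset ι) (hcard : ∀ j, (P j).card ≤ Δ)
    (hdis : ∀ j k, j ≠ k → Disjoint (P j) (P k)) :
    (Measure.pi fun _ : ι => ν).real
      {ω | ¬ ∃ g : A → A, Function.Injective g ∧ ∀ a, ∀ i ∈ P (a, g a), ω i = true} ≤
      (Fintype.card A : ℝ) / (n : ℝ) ^ 2 := by
  classical
  set μ := Measure.pi fun _ : ι => ν with hμ
  set m := Fintype.card A with hm
  have hsub : {ω : ι → Bool | ¬ ∃ g : A → A, Function.Injective g ∧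
      ∀ a, ∀ i ∈ P (a, g a), ω i = true} ⊆
      ⋃ k ∈ Finset.Icc 1 m, ⋃ ST ∈ Finset.powersetCard k (Finset.univ : Finset A) ×ˢ
        Finset.powersetCard (m + 1 - k) (Finset.univ : Finset A),
        {ω | ∀ j ∈ ST.1 ×ˢ ST.2, ¬ ∀ i ∈ P j, ω i = true} := by
    intro ω hω
    obtain ⟨k, hk, S, hS, T, hT, h⟩ := af_hall (fun a b => ∀ i ∈ P (a, b), ω i = true) hω
    simp only [Set.mem_iUnion]
    refine ⟨k, hk, (S, T), Finset.mem_product.2 ⟨hS, hT⟩, ?_⟩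
    rintro ⟨a, b⟩ hj
    rw [Finset.mem_product] at hj
    exact h a hj.1 b hj.2
  refine (measureReal_mono hsub (measure_ne_top _ _)).trans ((measureReal_biUnion_finset_le _ _).trans ?_)
  have hk : ∀ k ∈ Finset.Icc 1 m, μ.real (⋃ ST ∈ Finset.powersetCard k (Finset.univ : Finset A) ×ˢ
        Finset.powersetCard (m + 1 - k) (Finset.univ : Finset A),
        {ω | ∀ j ∈ ST.1 ×ˢ ST.2, ¬ ∀ i ∈ P j, ω i = true}) ≤ 1 / (n : ℝ) ^ 2 := by
    intro k hk
    rw [Finset.mem_Icc] at hk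
    refine (measureReal_biUnion_finset_le _ _).trans ?_
    have hb : ∀ ST ∈ Finset.powersetCard k (Finset.univ : Finset A) ×ˢ
        Finset.powersetCard (m + 1 - k) (Finset.univ : Finset A),
        μ.real {ω | ∀ j ∈ ST.1 ×ˢ ST.2, ¬ ∀ i ∈ P j, ω i = true} ≤
          (1 - p ^ Δ) ^ (k * (m + 1 - k)) := by
      intro ST hST
      rw [Finset.mem_product, Finset.mem_powersetCard, Finset.mem_powersetCard] at hST
      have := af_block ν p hν hp0 hp1 Δ (ST.1 ×ˢ ST.2) P (fun j _ => hcard j)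
        (fun j _ k _ => hdis j k)
      rwa [Finset.card_product, hST.1.2, hST.2.2] at this
    refine (Finset.sum_le_sum hb).trans ?_
    rw [Finset.sum_const, Finset.card_product, Finset.card_powersetCard,
      Finset.card_powersetCard, Finset.card_univ, ← hm, nsmul_eq_mul]
    push_cast
    exact af_num n m k (p ^ Δ) hn hAn hk.1 hk.2 (pow_nonneg hp0 _) (pow_le_one₀ hp0 hp1) hq
  refine (Finset.sum_le_sum hk).trans ?_
  rw [Finset.sum_const, Nat.card_Icc, nsmul_eq_mul]
  simp [div_eq_mul_inv]

end AFmatch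

section AFmain

/-- there is a colour-preserving partial embedding of the first `i` classes -/
def afE {n : ℕ} (H : SimpleGraph (Fin n)) (c : Fin n → ℕ) (i : ℕ) :
    Set (Sym2 (Fin n) → Bool) :=
  {ω | ∃ f : Equiv.Perm (Fin n), (∀ v, c (f v) = c v) ∧
    ∀ u v, H.Adj u v → c u < i → c v < i → ω s(f u, f v) = true}

lemma af_step {n : ℕ} (hn : 1 ≤ n) (H : SimpleGraph (Fin n)) (c : Fin n → ℕ) (Δ i : ℕ)
    (ν : Measure Bool) [IsProbabilityMeasure ν] (p : ℝ)
    (hν : ν.real {true} = p) (hp0 : 0 ≤ p) (hp1 : p ≤ 1)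
    (hΔ : ∀ v, (H.neighborSet v).ncard ≤ Δ)
    (hc1 : ∀ v w, H.Adj v w → c v ≠ c w)
    (hc2 : ∀ u v w, v ≠ w → H.Adj u v → H.Adj u w → c v ≠ c w)
    (hq : 3 * Real.log n ≤
      p ^ Δ * ((Finset.univ.filter (fun v => c v = i)).card : ℝ) / 2) :
    (Measure.pi fun _ : Sym2 (Fin n) => ν).real (afE H c (i + 1))ᶜ ≤
      (Measure.pi fun _ : Sym2 (Fin n) => ν).real (afE H c i)ᶜ +
        ((Finset.univ.filter (fun v => c v = i)).card : ℝ) / (n : ℝ) ^ 2 := by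
  classical
  let A := {v : Fin n // c v = i}
  have hA : Fintype.card A = (Finset.univ.filter (fun v => c v = i)).card :=
    Fintype.card_subtype _
  let S : Finset (Sym2 (Fin n)) := Finset.univ.filter (fun e => ∀ x ∈ e, c x < i)
  let T : Finset (Sym2 (Fin n)) := Finset.univ.filter (fun e => ∃ x ∈ e, c x = i)
  have hST : Disjoint S T := by
    rw [Finset.disjoint_left]
    intro e h1 h2
    simp only [S, T, Finset.mem_filter, Finset.mem_univ, true_and] at h1 h2
    obtain ⟨x, hx, hxi⟩ := h2
    have := h1 x hx
    omega
  let mask : (Sym2 (Fin n) → Bool) → (Sym2 (Fin n) → Bool) :=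
    fun ω e => if e ∈ S then ω e else false
  have hmask : ∀ ω e, mask ω e = true → ω e = true := by
    intro ω e h
    by_cases he : e ∈ S
    · simpa [mask, he] using h
    · simp [mask, he] at h
  have hmaskE : ∀ ω ∈ afE H c i, mask ω ∈ afE H c i := by
    rintro ω ⟨f, hf, h⟩
    refine ⟨f, hf, fun u v huv hu hv => ?_⟩
    have he : s(f u, f v) ∈ S := by
      simp only [S, Finset.mem_filter, Finset.mem_univ, true_and, Sym2.mem_iff]
      rintro x (rfl | rfl)
      · rwa [hf]
      · rwa [hf]
    simp only [mask, he, if_true]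
    exact h u v huv hu hv
  let X : (Sym2 (Fin n) → Bool) → Equiv.Perm (Fin n) := fun ω =>
    if h : mask ω ∈ afE H c i then h.choose else 1
  have hXc : ∀ ω v, c (X ω v) = c v := by
    intro ω
    by_cases h : mask ω ∈ afE H c i
    · simp only [X, h, dif_pos]; exact h.choose_spec.1
    · simp [X, h]
  have hXE : ∀ ω ∈ afE H c i, ∀ u v, H.Adj u v → c u < i → c v < i →
      ω s(X ω u, X ω v) = true := by
    intro ω hω u v huv hu hv
    have h := hmaskE ω hω
    apply hmask
    simp only [X, h, dif_pos]
    exact h.choose_spec.2 u v huv hu hv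
  let P : Equiv.Perm (Fin n) → A × A → Finset (Sym2 (Fin n)) := fun f j =>
    (Finset.univ.filter (fun u => H.Adj j.1.1 u ∧ c u < i)).image (fun u => s(f u, j.2.1))
  let B : Equiv.Perm (Fin n) → Set (Sym2 (Fin n) → Bool) := fun f =>
    {ω | ¬ ∃ g : A → A, Function.Injective g ∧ ∀ a, ∀ e ∈ P f (a, g a), ω e = true}
  have hB : (Measure.pi fun _ : Sym2 (Fin n) => ν).real {ω | ω ∈ B (X ω)} ≤
      ((Finset.univ.filter (fun v => c v = i)).card : ℝ) / (n : ℝ) ^ 2 := by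
    apply af_decouple ν S T hST X B
    · intro ω ω' h
      have : mask ω = mask ω' := by
        funext e
        by_cases he : e ∈ S
        · simp [mask, he, h e he]
        · simp [mask, he]
      simp only [X, this]
    · intro f ω ω' h hω
      simp only [B, Set.mem_ofPred_eq] at hω ⊢
      rintro ⟨g, hg, hg'⟩
      refine hω ⟨g, hg, fun a e he => ?_⟩
      rw [h e ?_]
      · exact hg' a e he
      · obtain ⟨u, hu, rfl⟩ := Finset.mem_image.1 he
        simp only [T, Finset.mem_filter, Finset.mem_univ, true_and]
        exact ⟨(g a).1, by simp, (g a).2⟩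
    · intro ω
      rw [← hA]
      have hcX := hXc ω
      generalize X ω = f at hcX
      apply af_match ν p hν hp0 hp1 Δ n hn
      · rw [hA]; simpa using Finset.card_le_univ (Finset.univ.filter (fun v => c v = i))
      · rw [hA]; exact hq
      · intro j
        refine Finset.card_image_le.trans (le_trans ?_ (hΔ j.1.1))
        rw [← Set.ncard_coe_finset]
        apply Set.ncard_le_ncard _ (Set.toFinite _)
        intro u hu
        simp at hu
        exact hu.1
      · rintro ⟨a, x⟩ ⟨b, y⟩ hne
        rw [Finset.disjoint_left]
        intro e h1 h2
        obtain ⟨u, hu, rfl⟩ := Finset.mem_image.1 h1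
        obtain ⟨w, hw, he⟩ := Finset.mem_image.1 h2
        simp only [Finset.mem_filter, Finset.mem_univ, true_and] at hu hw
        have hux : f u ≠ y.1 := by
          intro h
          have := hcX u
          rw [h, y.2] at this
          omega
        rw [Sym2.eq_iff] at he
        rcases he with ⟨h3, h4⟩ | ⟨h3, h4⟩
        · have huw : w = u := f.injective h3
          subst huw
          apply hne
          have hxy : x = y := Subtype.ext h4.symm
          have hab : a = b := by
            by_contra hab
            exact hc2 w a.1 b.1 (fun h => hab (Subtype.ext h)) hu.1.symm hw.1.symm
              (a.2.trans b.2.symm)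
          rw [hxy, hab]
        · exact hux h4.symm
  have hsub : (afE H c (i + 1))ᶜ ⊆ (afE H c i)ᶜ ∪ {ω | ω ∈ B (X ω)} := by
    intro ω hω
    by_contra hcon
    simp only [Set.mem_union, Set.mem_compl_iff, not_or, not_not, Set.mem_ofPred_eq, B] at hcon
    obtain ⟨hE, g, hg, hgP⟩ := hcon
    apply hω
    have hXω := hXE ω hE
    have hcX := hXc ω
    generalize X ω = f at hXω hcX hgP
    let F : Fin n → Fin n := fun v => if h : c v = i then (g ⟨v, h⟩).1 else f v
    have hF1 : ∀ v (h : c v = i), F v = (g ⟨v, h⟩).1 := fun v h => by simp [F, h]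
    have hF2 : ∀ v, c v ≠ i → F v = f v := fun v h => by simp [F, h]
    have hFc : ∀ v, c (F v) = c v := by
      intro v
      by_cases h : c v = i
      · rw [hF1 v h, (g ⟨v, h⟩).2, h]
      · rw [hF2 v h, hcX]
    have hFinj : Function.Injective F := by
      intro v w hvw
      have hcc : c v = c w := by rw [← hFc v, ← hFc w, hvw]
      by_cases h : c v = i
      · have h' : c w = i := hcc ▸ h
        rw [hF1 v h, hF1 w h'] at hvw
        have := hg (Subtype.ext hvw)
        exact congrArg Subtype.val this
      · have h' : c w ≠ i := hcc ▸ h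
        rw [hF2 v h, hF2 w h'] at hvw
        exact f.injective hvw
    have key : ∀ u v, H.Adj u v → c u < i → c v = i → ω s(F u, F v) = true := by
      intro u v huv hu hv
      rw [hF1 v hv, hF2 u (by omega)]
      apply hgP ⟨v, hv⟩
      exact Finset.mem_image.2 ⟨u, by simp [huv.symm, hu], rfl⟩
    refine ⟨Equiv.ofBijective F (Finite.injective_iff_bijective.1 hFinj), hFc, ?_⟩
    intro u v huv hu hv
    change ω s(F u, F v) = true
    have hne := hc1 u v huv
    by_cases h1 : c u = i
    · rw [Sym2.eq_swap]
      exact key v u huv.symm (by omega) h1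
    · by_cases h2 : c v = i
      · exact key u v huv (by omega) h2
      · rw [hF2 u h1, hF2 v h2]
        exact hXω u v huv (by omega) (by omega)
  calc _ ≤ (Measure.pi fun _ : Sym2 (Fin n) => ν).real ((afE H c i)ᶜ ∪ {ω | ω ∈ B (X ω)}) :=
        measureReal_mono hsub
    _ ≤ _ := measureReal_union_le _ _
    _ ≤ _ := by gcongr

lemma af_fixed {n : ℕ} (hn : 400 ≤ n) (H : SimpleGraph (Fin n)) (Δ : ℕ) (hΔ1 : 1 ≤ Δ)
    (ν : Measure Bool) [IsProbabilityMeasure ν] (p : ℝ)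
    (hν : ν.real {true} = p) (hp0 : 0 ≤ p) (hp1 : p ≤ 1)
    (hΔ : ∀ v, (H.neighborSet v).ncard ≤ Δ)
    (hΔn : (Δ : ℝ) ^ 2 ≤ Real.sqrt n - 1)
    (hp : ((20 * (Δ : ℝ) ^ 2 * Real.log n) / n) ^ (1 / (Δ : ℝ)) ≤ p) :
    (Measure.pi fun _ : Sym2 (Fin n) => ν).real {ω | ContainsCopy H (graphOf ω)}ᶜ ≤
      1 / (n : ℝ) := by
  classical
  have hn1 : (400 : ℝ) ≤ n := by exact_mod_cast hn
  have hn0 : (0 : ℝ) < n := by linarith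
  have hlog : 0 ≤ Real.log n := Real.log_nonneg (by linarith)
  set q := p ^ Δ with hqdef
  have hq0 : 0 ≤ q := pow_nonneg hp0 _
  have hqge : (20 * (Δ : ℝ) ^ 2 * Real.log n) / n ≤ q := by
    have hx : 0 ≤ (20 * (Δ : ℝ) ^ 2 * Real.log n) / n := by positivity
    have h := pow_le_pow_left₀ (Real.rpow_nonneg hx _) hp Δ
    rw [one_div, Real.rpow_inv_natCast_pow hx (by omega)] at h
    exact h
  set s := n / (2 * Δ ^ 2 + 1) with hs
  obtain ⟨c, hc0, hc1, hc2, hc3⟩ := af_square H Δ hΔ s (by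
    rw [Fintype.card_fin]; exact Nat.div_mul_le_self _ _)
  have hD1 : (1 : ℝ) ≤ (Δ : ℝ) ^ 2 := by
    have : (1 : ℝ) ≤ Δ := by exact_mod_cast hΔ1
    exact one_le_pow₀ this
  have hsn : (n : ℝ) ≤ s * (2 * (Δ : ℝ) ^ 2 + 1) + 2 * (Δ : ℝ) ^ 2 := by
    have h1 := Nat.div_add_mod n (2 * Δ ^ 2 + 1)
    have h2 := Nat.mod_lt n (show 0 < 2 * Δ ^ 2 + 1 by omega)
    have h3 : n ≤ s * (2 * Δ ^ 2 + 1) + 2 * Δ ^ 2 := by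
      rw [hs, mul_comm]; omega
    exact_mod_cast h3
  have hDs : 3 * (n : ℝ) ≤ 10 * (Δ : ℝ) ^ 2 * s := by
    have hsq : Real.sqrt n * Real.sqrt n = n := Real.mul_self_sqrt hn0.le
    have h20 : (20 : ℝ) ≤ Real.sqrt n := Real.le_sqrt_of_sq_le (by norm_num; linarith)
    set D := (Δ : ℝ) ^ 2 with hD
    have h1 : 20 * D ≤ n := by nlinarith
    have h2 : 3 * (n : ℝ) * (2 * D + 1) ≤ 10 * D * s * (2 * D + 1) := by
      nlinarith
    exact le_of_mul_le_mul_right h2 (by linarith)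
  have hq : ∀ i < Δ ^ 2 + 1, 3 * Real.log n ≤
      q * ((Finset.univ.filter (fun v => c v = i)).card : ℝ) / 2 := by
    intro i hi
    have h1 : (s : ℝ) ≤ ((Finset.univ.filter (fun v => c v = i)).card : ℝ) := by
      exact_mod_cast hc3 i hi
    have h2 : (20 * (Δ : ℝ) ^ 2 * Real.log n) / n * s ≤
        q * ((Finset.univ.filter (fun v => c v = i)).card : ℝ) := by gcongr
    have h3 : 6 * Real.log n ≤ (20 * (Δ : ℝ) ^ 2 * Real.log n) / n * s := by
      rw [div_mul_eq_mul_div, le_div_iff₀ hn0]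
      nlinarith
    linarith
  have hind : ∀ i ≤ Δ ^ 2 + 1, (Measure.pi fun _ : Sym2 (Fin n) => ν).real (afE H c i)ᶜ ≤
      ∑ j ∈ Finset.range i, ((Finset.univ.filter (fun v => c v = j)).card : ℝ) / (n : ℝ) ^ 2 := by
    intro i
    induction i with
    | zero =>
      intro _
      have : afE H c 0 = Set.univ := by
        ext ω
        simp only [Set.mem_univ, iff_true]
        exact ⟨1, by simp, by simp⟩
      simp [this]
    | succ i ih =>
      intro hi
      rw [Finset.sum_range_succ]
      have := af_step (by omega) H c Δ i ν p hν hp0 hp1 hΔ hc1 hc2 (hq i (by omega))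
      have := ih (by omega)
      linarith
  have hsum : ∑ j ∈ Finset.range (Δ ^ 2 + 1),
      ((Finset.univ.filter (fun v => c v = j)).card : ℝ) / (n : ℝ) ^ 2 = 1 / n := by
    rw [← Finset.sum_div]
    have : ∑ j ∈ Finset.range (Δ ^ 2 + 1), (Finset.univ.filter (fun v => c v = j)).card = n := by
      rw [← Finset.card_eq_sum_card_fiberwise (f := c) (s := Finset.univ)]
      · simp
      · intro v _; simpa using hc0 v
    have h2 : ∑ j ∈ Finset.range (Δ ^ 2 + 1),
        ((Finset.univ.filter (fun v => c v = j)).card : ℝ) = n := by exact_mod_cast this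
    rw [h2]
    field_simp
  rw [← hsum]
  refine le_trans (measureReal_mono ?_) (hind _ le_rfl)
  rw [Set.compl_subset_compl]
  rintro ω ⟨f, hf, h⟩
  refine ⟨f, f.injective, fun u v huv => ?_⟩
  rw [graphOf, SimpleGraph.fromRel_adj]
  exact ⟨fun he => huv.ne (f.injective he), Or.inl (h u v huv (hc0 u) (hc0 v))⟩

end AFmain

/-- **Alon–Füredi theorem.** If `(H_n)` is a sequence of spanning graphs whose maximum degree
`Δ = Δ(H_n)` satisfies `Δ² ≤ √n - 1`, and `p ≥ (20·Δ²·log n / n)^{1/Δ}`, then a.a.s.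
`G(n,p)` contains a copy of `H_n`. -/
theorem stmt_4 (H : ∀ n : ℕ, SimpleGraph (Fin n)) (p : ℕ → ℝ)
    (hp : ∀ n, 0 ≤ p n ∧ p n ≤ 1)
    (hΔ : ∀ᶠ n : ℕ in atTop, ((maxDeg (H n) : ℝ)) ^ 2 ≤ Real.sqrt n - 1)
    (hpge : ∀ᶠ n : ℕ in atTop,
      ((20 * (maxDeg (H n) : ℝ) ^ 2 * Real.log n) / n) ^ (1 / (maxDeg (H n) : ℝ)) ≤ p n) :
    Tendsto (fun n : ℕ => gnp n (p n) {ω | ContainsCopy (H n) (graphOf ω)}) atTop (𝓝 1) := by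
  have hprob : ∀ n, IsProbabilityMeasure (bernoulliMeasure (p n)) := by
    intro n
    constructor
    simp [bernoulliMeasure]
  have hprob' : ∀ n, IsProbabilityMeasure (gnp n (p n)) := by
    intro n
    have := hprob n
    unfold gnp
    infer_instance
  have hν : ∀ n, (bernoulliMeasure (p n)).real {true} = p n := by
    intro n
    have h1 : ENNReal.ofReal (p n) ≤ 1 := by
      simpa using ENNReal.ofReal_le_ofReal (hp n).2
    simp [bernoulliMeasure, measureReal_def, h1, (hp n).1]
  have hmain : ∀ᶠ n : ℕ in atTop, ENNReal.ofReal (1 - 1 / (n : ℝ)) ≤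
      gnp n (p n) {ω | ContainsCopy (H n) (graphOf ω)} := by
    filter_upwards [hΔ, hpge, eventually_ge_atTop 400] with n h1 h2 h3
    have := hprob n
    have := hprob' n
    have hdeg : ∀ v, ((H n).neighborSet v).ncard ≤ maxDeg (H n) := fun v =>
      Finset.le_sup (f := fun v => ((H n).neighborSet v).ncard) (Finset.mem_univ v)
    rcases Nat.eq_zero_or_pos (maxDeg (H n)) with h0 | hpos
    · have : {ω : Sym2 (Fin n) → Bool | ContainsCopy (H n) (graphOf ω)} = Set.univ := by
        ext ω
        simp only [Set.mem_univ, iff_true]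
        refine ⟨id, Function.injective_id, fun u v huv => ?_⟩
        exfalso
        have hu := hdeg u
        rw [h0, Nat.le_zero, Set.ncard_eq_zero (Set.toFinite _)] at hu
        have : v ∈ (H n).neighborSet u := huv
        rw [hu] at this
        exact this
      rw [this, measure_univ]
      apply ENNReal.ofReal_le_one.2
      have : 0 ≤ 1 / (n : ℝ) := by positivity
      linarith
    · have h := af_fixed h3 (H n) (maxDeg (H n)) hpos (bernoulliMeasure (p n)) (p n) (hν n)
        (hp n).1 (hp n).2 hdeg h1 h2
      change (gnp n (p n)).real _ ≤ _ at h
      rw [probReal_compl_eq_one_sub (Set.toFinite _).measurableSet] at h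
      apply ENNReal.ofReal_le_of_le_toReal
      rw [measureReal_def] at h
      linarith
  have hlim : Tendsto (fun n : ℕ => ENNReal.ofReal (1 - 1 / (n : ℝ))) atTop (𝓝 1) := by
    have : Tendsto (fun n : ℕ => 1 - 1 / (n : ℝ)) atTop (𝓝 (1 - 0)) :=
      tendsto_const_nhds.sub tendsto_one_div_atTop_nhds_zero_nat
    simpa using ENNReal.tendsto_ofReal this
  refine tendsto_of_tendsto_of_tendsto_of_le_of_le' hlim tendsto_const_nhds hmain ?_
  filter_upwards with n
  have := hprob' n
  exact prob_le_one
end
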